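/- Let r ≥ 3 and k ≥ 1 be integers. There exist an integer m_0 = m_0(r,k) and an absolute constant c > 0 such that for all m ≥ m_0, D_r^{smp}(m,k) ≥ t_{r-2}(c · k^{2^{4-r} - 2} · m^{2^{4-r}}), where t_0(x) = x and t_{i+1}(x) = 2^{t_i(x)}. -/

import Mathlib

/-- The coloring `c` is monochromatic on the `r`-subsets of `S`. -/
def IsMonoOn (c : Finset ℕ → Bool) (r : ℕ) (S : Finset ℕ) : Prop :=
  ∃ col : Bool, ∀ P ⊆ S, P.card = r → c P = col

/-- `R_r(m)`: the least `N` such that every 2-coloring of the `r`-subsets of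
`{1,…,N}` admits a monochromatic set of size `m`. -/
noncomputable def ramseyNumber (r m : ℕ) : ℕ :=
  sInf {N : ℕ | ∀ c : Finset ℕ → Bool,
    ∃ S ⊆ Finset.Icc 1 N, S.card = m ∧ IsMonoOn c r S}

/-- The coloring `c` admits a monochromatic `(r,m,k)`-daisy inside `{1,…,N}`. -/
def HasMonoDaisy (r m k N : ℕ) (c : Finset ℕ → Bool) : Prop :=
  ∃ K M : Finset ℕ, K ∪ M ⊆ Finset.Icc 1 N ∧ Disjoint K M ∧
    K.card = k ∧ M.card = m ∧
    ∃ col : Bool, ∀ P ⊆ M, P.card = r → c (K ∪ P) = col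

/-- `D_r(m,k)`: the daisy Ramsey number. -/
noncomputable def daisyRamsey (r m k : ℕ) : ℕ :=
  sInf {N : ℕ | ∀ c : Finset ℕ → Bool, HasMonoDaisy r m k N c}

/-- The coloring `c` admits a monochromatic simple `(r,m,k)`-daisy inside `{1,…,N}`:
the kernel splits as `K₀ ∪ K₁` with `K₀ < M < K₁`. -/
def HasMonoSimpleDaisy (r m k N : ℕ) (c : Finset ℕ → Bool) : Prop :=
  ∃ K₀ M K₁ : Finset ℕ, K₀ ∪ M ∪ K₁ ⊆ Finset.Icc 1 N ∧
    (∀ x ∈ K₀, ∀ y ∈ M, x < y) ∧ (∀ y ∈ M, ∀ z ∈ K₁, y < z) ∧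
    (∀ x ∈ K₀, ∀ z ∈ K₁, x < z) ∧
    (K₀ ∪ K₁).card = k ∧ M.card = m ∧
    ∃ col : Bool, ∀ P ⊆ M, P.card = r → c (K₀ ∪ P ∪ K₁) = col

/-- `D_r^{smp}(m,k)`: the simple-daisy Ramsey number. -/
noncomputable def simpleDaisyRamsey (r m k : ℕ) : ℕ :=
  sInf {N : ℕ | ∀ c : Finset ℕ → Bool, HasMonoSimpleDaisy r m k N c}

/-- The tower function: `t_0(x) = x`, `t_{i+1}(x) = 2^{t_i(x)}`. -/
noncomputable def tower : ℕ → ℝ → ℝ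
  | 0, x => x
  | i + 1, x => 2 ^ tower i x

/-- Finite binary trees whose inner nodes carry a level. -/
inductive BTree
  | leaf : BTree
  | node : ℕ → BTree → BTree → BTree

namespace BTree

/-- The number of leaves. -/
def size : BTree → ℕ
  | leaf => 1
  | node _ l r => l.size + r.size

/-- The left-right reflection of a tree. -/
def mirror : BTree → BTree
  | leaf => leaf
  | node a l r => node a r.mirror l.mirror

/-- `Sub p t`: the tree `p` is induced by a nonempty set of leaves of `t`. -/
inductive Sub : BTree → BTree → Prop
  | leaf : Sub leaf leaf
  | left {p l r : BTree} {a : ℕ} : Sub p l → Sub p (node a l r)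
  | right {p l r : BTree} {a : ℕ} : Sub p r → Sub p (node a l r)
  | node {p q l r : BTree} {a : ℕ} : Sub p l → Sub q r → Sub (node a p q) (node a l r)

/-- The levels of `t` lie in `[1, b]` and strictly decrease from the root downwards. -/
def Valid : ℕ → BTree → Prop
  | _, leaf => True
  | b, node a l r => 1 ≤ a ∧ a ≤ b ∧ Valid (a - 1) l ∧ Valid (a - 1) r

/-- The largest number of inner nodes in an induced left comb. -/
def lc : BTree → ℕ
  | leaf => 0
  | node _ l r => max (l.lc + 1) r.lc

/-- The largest number of inner nodes in an induced right comb. -/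
def rc : BTree → ℕ
  | leaf => 0
  | node _ l r => max l.rc (r.rc + 1)

/-- `LComb V p E`: the tree `p` is a left comb over `V`, built with the levels in `E`. -/
inductive LComb (V : BTree) : BTree → Finset ℕ → Prop
  | base : LComb V V ∅
  | node {p : BTree} {E : Finset ℕ} {a : ℕ} :
      LComb V p E → (∀ x ∈ E, x < a) → LComb V (node a p leaf) (insert a E)

@[simp] lemma size_leaf : leaf.size = 1 := rfl

@[simp] lemma size_node (a : ℕ) (l r : BTree) : (node a l r).size = l.size + r.size := rfl

lemma size_pos (t : BTree) : 1 ≤ t.size := by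
  induction t with
  | leaf => simp
  | node a l r hl hr => simp; omega

lemma eq_leaf_of_size {t : BTree} (h : t.size = 1) : t = leaf := by
  cases t with
  | leaf => rfl
  | node a l r =>
    have := l.size_pos
    have := r.size_pos
    simp at h
    omega

@[simp] lemma mirror_mirror (t : BTree) : t.mirror.mirror = t := by
  induction t with
  | leaf => rfl
  | node a l r hl hr => simp [mirror, hl, hr]

@[simp] lemma size_mirror (t : BTree) : t.mirror.size = t.size := by
  induction t with
  | leaf => rfl
  | node a l r hl hr => simp [mirror, hl, hr, add_comm]

@[simp] lemma lc_mirror (t : BTree) : t.mirror.lc = t.rc := by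
  induction t with
  | leaf => rfl
  | node a l r hl hr => simp [mirror, lc, rc, hl, hr, max_comm]

@[simp] lemma rc_mirror (t : BTree) : t.mirror.rc = t.lc := by
  simpa using (lc_mirror t.mirror).symm

lemma Valid.mirror {b : ℕ} {t : BTree} (h : Valid b t) : Valid b t.mirror := by
  induction t generalizing b with
  | leaf => trivial
  | node a l r hl hr => exact ⟨h.1, h.2.1, hr h.2.2.2, hl h.2.2.1⟩

lemma Valid.mono {b c : ℕ} {t : BTree} (h : Valid b t) (hbc : b ≤ c) : Valid c t := by
  cases t with
  | leaf => trivial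
  | node a l r => exact ⟨h.1, h.2.1.trans hbc, h.2.2⟩

lemma Sub.refl (t : BTree) : Sub t t := by
  induction t with
  | leaf => exact .leaf
  | node a l r hl hr => exact .node hl hr

lemma sub_leaf (t : BTree) : Sub leaf t := by
  induction t with
  | leaf => exact .leaf
  | node a l r hl hr => exact .left hl

lemma Sub.trans {p q t : BTree} (h : Sub q t) : Sub p q → Sub p t := by
  induction h generalizing p with
  | leaf => exact id
  | left _ ih => exact fun hp => .left (ih hp)
  | right _ ih => exact fun hp => .right (ih hp)
  | node _ _ ih₁ ih₂ =>
    intro hp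
    cases hp with
    | left h => exact .left (ih₁ h)
    | right h => exact .right (ih₂ h)
    | node h h' => exact .node (ih₁ h) (ih₂ h')

lemma Sub.mirror {p t : BTree} (h : Sub p t) : Sub p.mirror t.mirror := by
  induction h with
  | leaf => exact .leaf
  | left _ ih => exact .right ih
  | right _ ih => exact .left ih
  | node _ _ ih₁ ih₂ => exact .node ih₂ ih₁

lemma exists_cherry {t : BTree} (h : 2 ≤ t.size) : ∃ a, Sub (node a leaf leaf) t := by
  cases t with
  | leaf => simp at h
  | node a l r => exact ⟨a, .node (sub_leaf l) (sub_leaf r)⟩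

lemma size_le_two_pow (t : BTree) : t.size ≤ 2 ^ (t.lc + t.rc) := by
  induction t with
  | leaf => simp [lc, rc]
  | node a l r hl hr =>
    obtain ⟨n, hn⟩ : ∃ n, (node a l r).lc + (node a l r).rc = n + 1 :=
      ⟨_, (Nat.succ_pred_eq_of_pos (by simp [lc])).symm⟩
    have h₁ : l.lc + l.rc ≤ n := by simp only [lc, rc] at hn; omega
    have h₂ : r.lc + r.rc ≤ n := by simp only [lc, rc] at hn; omega
    have h₃ := Nat.pow_le_pow_right (n := 2) (by norm_num) h₁
    have h₄ := Nat.pow_le_pow_right (n := 2) (by norm_num) h₂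
    rw [hn, pow_succ, size_node]
    omega

lemma LComb.size_eq {V p : BTree} {E : Finset ℕ} (h : LComb V p E) :
    p.size = E.card + V.size := by
  induction h with
  | base => simp
  | node _ hlt ih =>
    rw [Finset.card_insert_of_notMem fun h => (hlt _ h).false]
    simp [ih]
    omega

lemma exists_lcomb {b : ℕ} {t : BTree} (ht : Valid b t) : ∃ D : Finset ℕ,
    D.card = t.lc ∧ D ⊆ Finset.Icc 1 b ∧ ∀ E ⊆ D, ∃ p, Sub p t ∧ LComb leaf p E := by
  induction t generalizing b with
  | leaf =>
    refine ⟨∅, rfl, by simp, fun E hE => ⟨leaf, .leaf, ?_⟩⟩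
    rw [Finset.subset_empty.mp hE]
    exact .base
  | node a l r hl hr =>
    obtain ⟨h1, hab, hvl, hvr⟩ := ht
    rcases le_total r.lc (l.lc + 1) with h | h
    · obtain ⟨D, hD, hDs, hDE⟩ := hl hvl
      have hlt : ∀ x ∈ D, x < a := fun x hx => by
        have := Finset.mem_Icc.mp (hDs hx)
        omega
      refine ⟨insert a D, ?_, ?_, fun E hE => ?_⟩
      · rw [Finset.card_insert_of_notMem fun h => (hlt _ h).false, hD, lc, max_eq_left h]
      · intro x hx
        rcases Finset.mem_insert.mp hx with rfl | hx
        · simp [h1, hab]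
        · have := Finset.mem_Icc.mp (hDs hx)
          simp; omega
      · by_cases ha : a ∈ E
        · have hE' : E.erase a ⊆ D := by
            rw [Finset.subset_insert_iff] at hE
            exact hE
          obtain ⟨p, hp, hpc⟩ := hDE _ hE'
          refine ⟨node a p leaf, .node hp (sub_leaf r), ?_⟩
          have := LComb.node hpc fun x hx => hlt x (hE' hx)
          rwa [Finset.insert_erase ha] at this
        · obtain ⟨p, hp, hpc⟩ := hDE E ((Finset.subset_insert_iff_of_notMem ha).mp hE)
          exact ⟨p, .left hp, hpc⟩
    · obtain ⟨D, hD, hDs, hDE⟩ := hr hvr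
      refine ⟨D, by rw [hD, lc, max_eq_right h], hDs.trans (Finset.Icc_subset_Icc_right (by omega)),
        fun E hE => ?_⟩
      obtain ⟨p, hp, hpc⟩ := hDE E hE
      exact ⟨p, .right hp, hpc⟩

end BTree

/-- The state of a tree in the step-up coloring: number of leaves, parity accumulated so far, and
the levels of the left and of the right path that end at the root. -/
@[ext] structure TreeState where
  size : ℕ
  bit : Bool
  lp : Option (Finset ℕ)
  rp : Option (Finset ℕ)

namespace TreeState

/-- The color contributed by a path. -/
def chi (φ : Finset ℕ → Bool) : Option (Finset ℕ) → Bool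
  | none => false
  | some S => φ S

@[simp] lemma chi_none (φ : Finset ℕ → Bool) : chi φ none = false := rfl

@[simp] lemma chi_some (φ : Finset ℕ → Bool) (S : Finset ℕ) : chi φ (some S) = φ S := rfl

/-- Adds a level to a path. -/
def push (a : ℕ) : Option (Finset ℕ) → Option (Finset ℕ)
  | none => some ∅
  | some S => some (insert a S)

@[simp] lemma push_none (a : ℕ) : push a none = some ∅ := rfl

/-- The path at a node of level `a`, given the path `o` of a child with `n` leaves whose sibling
has `n'` leaves. -/
def grow (q a n : ℕ) (o : Option (Finset ℕ)) (n' : ℕ) : Option (Finset ℕ) :=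
  if n' = 1 then push a o
  else if (n = 1 ∧ n' = q) ∨ (n ≠ 1 ∧ n' < q) then some ∅ else none

/-- The state at a node of level `a` with children in states `s` and `t`. -/
def join (q : ℕ) (φ : Finset ℕ → Bool) (a : ℕ) (s t : TreeState) : TreeState where
  size := s.size + t.size
  bit := s.bit ^^ t.bit ^^ (decide (s.size ≠ 1) && decide (t.size ≠ 1)) ^^ chi φ s.rp ^^ chi φ t.lp
    ^^ (decide (t.size ≠ 1) && chi φ s.lp) ^^ (decide (s.size ≠ 1) && chi φ t.rp)
  lp := grow q a s.size s.lp t.size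
  rp := grow q a t.size t.rp s.size

/-- The reflection of a state. -/
def swap (s : TreeState) : TreeState := ⟨s.size, s.bit, s.rp, s.lp⟩

lemma swap_join (q : ℕ) (φ : Finset ℕ → Bool) (a : ℕ) (s t : TreeState) :
    (join q φ a s t).swap = join q φ a t.swap s.swap := by
  ext1 <;> simp only [swap, join]
  · exact add_comm _ _
  · simp only [Bool.xor_comm, Bool.xor_left_comm, Bool.xor_assoc, Bool.and_comm]
    rfl

end TreeState

namespace BTree

open TreeState

variable (q : ℕ) (φ : Finset ℕ → Bool)

/-- The state of a tree. -/
def st : BTree → TreeState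
  | leaf => ⟨1, false, some ∅, some ∅⟩
  | node a l r => join q φ a l.st r.st

/-- The step-up color of a tree. -/
def col (t : BTree) : Bool := (t.st q φ).bit ^^ chi φ (t.st q φ).lp ^^ chi φ (t.st q φ).rp

@[simp] lemma st_size (t : BTree) : (t.st q φ).size = t.size := by
  induction t with
  | leaf => rfl
  | node a l r hl hr => simp [st, join, hl, hr]

lemma st_mirror (t : BTree) : t.mirror.st q φ = (t.st q φ).swap := by
  induction t with
  | leaf => rfl
  | node a l r hl hr => simp only [mirror, st, swap_join, hl, hr]

lemma col_mirror (t : BTree) : t.mirror.col q φ = t.col q φ := by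
  simp only [col, st_mirror, swap, Bool.xor_comm, Bool.xor_left_comm, Bool.xor_assoc]

lemma lp_bound {b : ℕ} {t : BTree} (ht : Valid b t) {S : Finset ℕ}
    (h : (t.st q φ).lp = some S) : S ⊆ Finset.Icc 1 b ∧ S.card < t.size := by
  induction t generalizing b S with
  | leaf =>
    simp [st] at h
    simp [← h]
  | node a l r hl hr =>
    obtain ⟨h1, hab, hvl, -⟩ := ht
    have := l.size_pos
    have := r.size_pos
    simp only [st, join, grow, st_size] at h
    split_ifs at h with h₁ h₂
    · cases ho : (l.st q φ).lp with
      | none =>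
        simp [ho, push] at h
        simp [← h]
        omega
      | some S' =>
        simp [ho, push] at h
        obtain ⟨h₃, h₄⟩ := hl hvl ho
        rw [← h]
        constructor
        · intro x hx
          rcases Finset.mem_insert.mp hx with rfl | hx
          · simp [h1, hab]
          · have := Finset.mem_Icc.mp (h₃ hx)
            simp; omega
        · have := Finset.card_insert_le a S'
          rw [size_node]
          omega
    · simp at h
      simp [← h]
      omega

lemma rp_bound {b : ℕ} {t : BTree} (ht : Valid b t) {S : Finset ℕ}
    (h : (t.st q φ).rp = some S) : S.card < t.size := by
  have := lp_bound q φ (t := t.mirror) ht.mirror (S := S) (by rw [st_mirror]; exact h)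
  simpa using this.2

end BTree

namespace BTree

open TreeState

variable {q : ℕ} {φ : Finset ℕ → Bool} {N : ℕ}

lemma Valid.sub {b : ℕ} {p t : BTree} (ht : Valid b t) (h : Sub p t) : Valid b p := by
  induction h generalizing b with
  | leaf => trivial
  | left _ ih => exact (ih ht.2.2.1).mono (by have := ht.2.1; omega)
  | right _ ih => exact (ih ht.2.2.2).mono (by have := ht.2.1; omega)
  | node _ _ ih₁ ih₂ => exact ⟨ht.1, ht.2.1, ih₁ ht.2.2.1, ih₂ ht.2.2.2⟩

/-- `IsCtx N lo w G`: the map `G` plugs a tree with levels at most `lo` into a hole of a bigger tree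
with levels at most `N` and with `w` further leaves. -/
inductive IsCtx (N : ℕ) : ℕ → ℕ → (BTree → BTree) → Prop
  | id {lo : ℕ} : IsCtx N lo 0 fun t => t
  | left {lo ℓ w : ℕ} {G : BTree → BTree} (s : BTree) : lo < ℓ → ℓ ≤ N → IsCtx N ℓ w G →
      IsCtx N lo (w + s.size) fun t => G (node ℓ t s)
  | right {lo ℓ w : ℕ} {G : BTree → BTree} (s : BTree) : lo < ℓ → ℓ ≤ N → IsCtx N ℓ w G →
      IsCtx N lo (w + s.size) fun t => G (node ℓ s t)

lemma IsCtx.anti {lo lo' w : ℕ} {G : BTree → BTree} (h : IsCtx N lo w G) (hl : lo' ≤ lo) :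
    IsCtx N lo' w G := by
  cases h with
  | id => exact .id
  | left s h₁ h₂ h₃ => exact .left s (hl.trans_lt h₁) h₂ h₃
  | right s h₁ h₂ h₃ => exact .right s (hl.trans_lt h₁) h₂ h₃

lemma IsCtx.mirror {lo w : ℕ} {G : BTree → BTree} (h : IsCtx N lo w G) :
    IsCtx N lo w fun t => (G t.mirror).mirror := by
  induction h with
  | id => simpa using IsCtx.id
  | left s h₁ h₂ _ ih => simpa [BTree.mirror] using IsCtx.right s.mirror h₁ h₂ ih
  | right s h₁ h₂ _ ih => simpa [BTree.mirror] using IsCtx.left s.mirror h₁ h₂ ih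

/-- Within a context, the color depends on the state only, and flips with its bit. -/
lemma IsCtx.col_eq_xor {lo w : ℕ} {G : BTree → BTree} (h : IsCtx N lo w G) (n : ℕ)
    (lp rp : Option (Finset ℕ)) :
    ∃ β, ∀ t b, t.st q φ = ⟨n, b, lp, rp⟩ → (G t).col q φ = (b ^^ β) := by
  induction h generalizing n lp rp with
  | id => exact ⟨chi φ lp ^^ chi φ rp, fun t b ht => by simp [col, ht]⟩
  | @left _ ℓ _ _ s _ _ _ ih =>
    set J := join q φ ℓ ⟨n, false, lp, rp⟩ (s.st q φ) with hJ
    obtain ⟨β, hβ⟩ := ih J.size J.lp J.rp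
    refine ⟨J.bit ^^ β, fun t b ht => ?_⟩
    rw [hβ _ (b ^^ J.bit) ?_, Bool.xor_assoc]
    simp [st, ht, hJ, join]
  | @right _ ℓ _ _ s _ _ _ ih =>
    set J := join q φ ℓ (s.st q φ) ⟨n, false, lp, rp⟩ with hJ
    obtain ⟨β, hβ⟩ := ih J.size J.lp J.rp
    refine ⟨J.bit ^^ β, fun t b ht => ?_⟩
    rw [hβ _ (b ^^ J.bit) ?_, Bool.xor_assoc]
    simp [st, ht, hJ, join, Bool.xor_left_comm]

lemma IsCtx.col_ne {lo w : ℕ} {G : BTree → BTree} (h : IsCtx N lo w G) {n : ℕ}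
    {lp rp : Option (Finset ℕ)} {b : Bool} {s t : BTree} (hs : s.st q φ = ⟨n, b, lp, rp⟩)
    (ht : t.st q φ = ⟨n, !b, lp, rp⟩) : (G s).col q φ ≠ (G t).col q φ := by
  obtain ⟨β, hβ⟩ := h.col_eq_xor (q := q) (φ := φ) n lp rp
  rw [hβ _ _ hs, hβ _ _ ht]
  cases b <;> simp

/-- Within a context, the color as a function of the left path. -/
lemma IsCtx.col_eq_path {lo w : ℕ} {G : BTree → BTree} (h : IsCtx N lo w G) (n : ℕ) (b : Bool)
    (ρ : Option (Finset ℕ)) :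
    ∃ b₀ L, L ⊆ Finset.Ioc lo N ∧ L.card ≤ w ∧
      ∀ t S, t.st q φ = ⟨n, b, some S, ρ⟩ → (G t).col q φ = (b₀ ^^ φ (S ∪ L)) := by
  induction h generalizing n b ρ with
  | id =>
    refine ⟨b ^^ chi φ ρ, ∅, by simp, by simp, fun t S ht => ?_⟩
    simp [col, ht, Bool.xor_comm, Bool.xor_left_comm]
  | @left lo ℓ _ _ s h₁ h₂ hG ih =>
    by_cases hs : s.size = 1
    · set J := join q φ ℓ ⟨n, b, none, ρ⟩ (s.st q φ) with hJ
      obtain ⟨b₀, L, hL, hLc, hb⟩ := ih J.size J.bit J.rp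
      refine ⟨b₀, insert ℓ L, ?_, ?_, fun t S ht => ?_⟩
      · intro x hx
        rcases Finset.mem_insert.mp hx with rfl | hx
        · simp [h₁, h₂]
        · have := Finset.mem_Ioc.mp (hL hx)
          simp; omega
      · have := Finset.card_insert_le ℓ L
        omega
      · rw [hb _ (insert ℓ S) ?_]
        · simp
        · simp [st, ht, hJ, join, hs, grow, push]
    · set J := join q φ ℓ ⟨n, b, none, ρ⟩ (s.st q φ) with hJ
      obtain ⟨β, hβ⟩ := hG.col_eq_xor (q := q) (φ := φ) J.size J.lp J.rp
      refine ⟨J.bit ^^ β, ∅, by simp, by simp, fun t S ht => ?_⟩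
      rw [hβ _ (J.bit ^^ φ S) ?_, Finset.union_empty, Bool.xor_assoc, Bool.xor_assoc,
        Bool.xor_comm β]
      simp [st, ht, hJ, join, hs, grow, Bool.xor_comm, Bool.xor_left_comm]
  | @right lo ℓ _ _ s h₁ h₂ hG ih =>
    set J := join q φ ℓ (s.st q φ) ⟨n, b, none, ρ⟩ with hJ
    obtain ⟨β, hβ⟩ := hG.col_eq_xor (q := q) (φ := φ) J.size J.lp J.rp
    refine ⟨J.bit ^^ β, ∅, by simp, by simp, fun t S ht => ?_⟩
    rw [hβ _ (J.bit ^^ φ S) ?_, Finset.union_empty, Bool.xor_assoc, Bool.xor_assoc,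
      Bool.xor_comm β]
    simp [st, ht, hJ, join, grow, Bool.xor_comm, Bool.xor_left_comm]

lemma chi_lp_eq_false (hφ : ∀ S : Finset ℕ, S.card < q → φ S = false) {b : ℕ} {t : BTree}
    (ht : Valid b t) (h : t.size ≤ q) : chi φ (t.st q φ).lp = false := by
  cases hl : (t.st q φ).lp with
  | none => rfl
  | some S => exact hφ _ ((lp_bound q φ ht hl).2.trans_le h)

lemma chi_rp_eq_false (hφ : ∀ S : Finset ℕ, S.card < q → φ S = false) {b : ℕ} {t : BTree}
    (ht : Valid b t) (h : t.size ≤ q) : chi φ (t.st q φ).rp = false := by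
  cases hl : (t.st q φ).rp with
  | none => rfl
  | some S => exact hφ _ ((rp_bound q φ ht hl).trans_le h)

/-- The right path of a left comb with level set `E`. -/
def combRp (q : ℕ) (E : Finset ℕ) : Option (Finset ℕ) :=
  if E.card ≤ 1 then some E else if E.card = q then some ∅ else none

lemma LComb.st_eq (hq : 3 ≤ q) (hφ : ∀ S : Finset ℕ, S.card < q → φ S = false) {p : BTree}
    {E : Finset ℕ} (h : LComb leaf p E) :
    p.st q φ = ⟨E.card + 1, false, some E, combRp q E⟩ := by
  have h0 : φ ∅ = false := hφ ∅ (by simp; omega)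
  have hc : ∀ E : Finset ℕ, chi φ (combRp q E) = false := by
    intro E
    unfold combRp
    split_ifs with h₁ h₂
    · exact hφ _ (by omega)
    · exact h0
    · rfl
  induction h with
  | base => rfl
  | @node p E a hp hlt ih =>
    have ha : (insert a E).card = E.card + 1 :=
      Finset.card_insert_of_notMem fun h => (hlt _ h).false
    rw [st, ih]
    ext1
    · simp [join, st, ha]
    · simp [join, st, h0, hc]
    · simp [join, st, grow, push]
    · rcases Finset.eq_empty_or_nonempty E with rfl | hE
      · simp [join, st, grow, push, combRp]
      · simp [join, st, grow, combRp, ha, hE.ne_empty]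

lemma st_cherry (hq : 3 ≤ q) (hφ : ∀ S : Finset ℕ, S.card < q → φ S = false) (a : ℕ) :
    (node a leaf leaf).st q φ = ⟨2, false, some {a}, some {a}⟩ := by
  simpa [combRp] using (LComb.node (a := a) LComb.base (by simp)).st_eq hq hφ

/-- Trees in which no node has a long comb on one side and a cherry on the other side. -/
def Good (q : ℕ) (t : BTree) : Prop :=
  ∀ a l r, Sub (node a l r) t → ¬ (q ≤ l.rc + 1 ∧ 2 ≤ r.size) ∧ ¬ (q ≤ r.lc + 1 ∧ 2 ≤ l.size)

lemma Good.sub {p t : BTree} (ht : Good q t) (h : Sub p t) : Good q p :=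
  fun a l r hs => ht a l r (h.trans hs)

lemma Good.mirror {t : BTree} (ht : Good q t) : Good q t.mirror := by
  intro a l r h
  have := ht a r.mirror l.mirror (by simpa [BTree.mirror] using h.mirror)
  simp only [lc_mirror, rc_mirror, size_mirror] at this
  exact this.symm

lemma size_lt_of_comb_lt {n : ℕ} {t : BTree} (hl : t.lc < n) (hr : t.rc < n) :
    t.size < 4 ^ n := by
  refine t.size_le_two_pow.trans_lt ?_
  rw [show (4 : ℕ) = 2 ^ 2 by norm_num, ← pow_mul]
  exact Nat.pow_lt_pow_right (by norm_num) (by omega)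

lemma Good.size_le_of_rc_lt {t : BTree} (ht : Good q t) (h : t.rc + 1 < q) :
    t.size ≤ 4 ^ (q + 1) * (t.lc + t.rc + 1) := by
  have hC : 1 ≤ 4 ^ (q + 1) := Nat.one_le_pow _ _ (by norm_num)
  induction t with
  | leaf => simpa [lc, rc] using hC
  | node a l r hl hr =>
    have hn := ht a l r (Sub.refl _)
    have h₁ : l.rc ≤ (node a l r).rc := le_max_left _ _
    have h₂ : r.rc + 1 ≤ (node a l r).rc := le_max_right _ _
    have h₃ : l.lc + 1 ≤ (node a l r).lc := le_max_left _ _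
    have h₄ : r.lc ≤ (node a l r).lc := le_max_right _ _
    rw [size_node]
    generalize (node a l r).lc = x at *
    generalize (node a l r).rc = y at *
    by_cases hs : 2 ≤ l.size
    · have hr' : r.size < 4 ^ (q + 1) := size_lt_of_comb_lt (by omega) (by omega)
      have hl' := hl (ht.sub (.left (Sub.refl l))) (by omega)
      have : 4 ^ (q + 1) * (l.lc + l.rc + 1 + 1) ≤ 4 ^ (q + 1) * (x + y + 1) :=
        Nat.mul_le_mul_left _ (by omega)
      rw [mul_add] at this
      omega
    · have hr' := hr (ht.sub (.right (Sub.refl r))) (by omega)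
      have : 4 ^ (q + 1) * (r.lc + r.rc + 1 + 1) ≤ 4 ^ (q + 1) * (x + y + 1) :=
        Nat.mul_le_mul_left _ (by omega)
      rw [mul_add] at this
      omega

lemma Good.size_le_of_lc_lt {t : BTree} (ht : Good q t) (h : t.lc + 1 < q) :
    t.size ≤ 4 ^ (q + 1) * (t.lc + t.rc + 1) := by
  have := ht.mirror.size_le_of_rc_lt (by simpa using h)
  simpa [add_comm t.rc] using this

lemma Good.size_le {t : BTree} (ht : Good q t) :
    t.size ≤ 2 * 4 ^ (q + 1) * (t.lc + t.rc + 1) := by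
  have hC : 1 ≤ 4 ^ (q + 1) := Nat.one_le_pow _ _ (by norm_num)
  induction t with
  | leaf => simp [lc, rc]; omega
  | node a l r hl hr =>
    have hn := ht a l r (Sub.refl _)
    have h₁ : l.rc ≤ (node a l r).rc := le_max_left _ _
    have h₂ : r.rc + 1 ≤ (node a l r).rc := le_max_right _ _
    have h₃ : l.lc + 1 ≤ (node a l r).lc := le_max_left _ _
    have h₄ : r.lc ≤ (node a l r).lc := le_max_right _ _
    have hgl := ht.sub (.left (Sub.refl l))
    have hgr := ht.sub (.right (Sub.refl r))
    rw [size_node]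
    generalize (node a l r).lc = x at *
    generalize (node a l r).rc = y at *
    generalize hC' : 4 ^ (q + 1) = C at *
    by_cases hs : 2 ≤ l.size
    · by_cases hs' : 2 ≤ r.size
      · have e₁ := hgl.size_le_of_rc_lt (by omega)
        have e₂ := hgr.size_le_of_lc_lt (by omega)
        rw [hC'] at e₁ e₂
        have e₃ : C * (l.lc + l.rc + 1) ≤ C * (x + y + 1) := Nat.mul_le_mul_left _ (by omega)
        have e₄ : C * (r.lc + r.rc + 1) ≤ C * (x + y + 1) := Nat.mul_le_mul_left _ (by omega)
        rw [mul_assoc, two_mul]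
        omega
      · have hl' := hl hgl
        have : 2 * C * (l.lc + l.rc + 1 + 1) ≤ 2 * C * (x + y + 1) :=
          Nat.mul_le_mul_left _ (by omega)
        rw [mul_add] at this
        omega
    · have hr' := hr hgr
      have : 2 * C * (r.lc + r.rc + 1 + 1) ≤ 2 * C * (x + y + 1) :=
        Nat.mul_le_mul_left _ (by omega)
      rw [mul_add] at this
      omega

end BTree

namespace BTree

open TreeState

variable {q k m N : ℕ} {φ : Finset ℕ → Bool}

/-- The coloring `φ` of `q`-sets has no small monochromatic simple daisy. -/
structure Base (q k m N : ℕ) (φ : Finset ℕ → Bool) : Prop where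
  three_le : 3 ≤ q
  vanish : ∀ S : Finset ℕ, S.card < q → φ S = false
  free : ∀ j ≤ k, ¬ HasMonoSimpleDaisy q m j N φ

lemma Base.not_const (h : Base q k m N φ) {lo hi : ℕ} {K₀ D K₁ : Finset ℕ} {c : Bool}
    (hN : hi ≤ N) (h₀ : K₀ ⊆ Finset.Icc 1 lo) (hD : D ⊆ Finset.Ioc lo hi)
    (h₁ : K₁ ⊆ Finset.Ioc hi N) (hk : K₀.card + K₁.card ≤ k) (hm : m ≤ D.card)
    (hc : ∀ E ⊆ D, E.card = q → φ (K₀ ∪ E ∪ K₁) = c) (hlo : lo ≤ hi) : False := by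
  obtain ⟨M, hMD, hM⟩ := Finset.exists_subset_card_eq hm
  refine h.free _ ((Finset.card_union_le K₀ K₁).trans hk) ⟨K₀, M, K₁, ?_, ?_, ?_, ?_, rfl, hM, c,
    fun E hE hE' => hc E (hE.trans hMD) hE'⟩
  · intro x hx
    simp only [Finset.mem_union] at hx
    rcases hx with (hx | hx) | hx
    · have := Finset.mem_Icc.mp (h₀ hx)
      simp; omega
    · have := Finset.mem_Ioc.mp (hD (hMD hx))
      simp; omega
    · have := Finset.mem_Ioc.mp (h₁ hx)
      simp; omega
  · intro x hx y hy
    have := Finset.mem_Icc.mp (h₀ hx)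
    have := Finset.mem_Ioc.mp (hD (hMD hy))
    omega
  · intro y hy z hz
    have := Finset.mem_Ioc.mp (h₁ hz)
    have := Finset.mem_Ioc.mp (hD (hMD hy))
    omega
  · intro x hx z hz
    have := Finset.mem_Ioc.mp (h₁ hz)
    have := Finset.mem_Icc.mp (h₀ hx)
    omega

/-- All trees with `q + 1` leaves induced by `t` get the same color when plugged into `G`. -/
def MonoSub (q : ℕ) (φ : Finset ℕ → Bool) (G : BTree → BTree) (t : BTree) : Prop :=
  ∃ c, ∀ p, Sub p t → p.size = q + 1 → (G p).col q φ = c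

lemma MonoSub.mirror {G : BTree → BTree} {t : BTree} (h : MonoSub q φ G t) :
    MonoSub q φ (fun t => (G t.mirror).mirror) t.mirror := by
  obtain ⟨c, hc⟩ := h
  refine ⟨c, fun p hp hs => ?_⟩
  rw [col_mirror]
  exact hc _ (by simpa using hp.mirror) (by simpa using hs)

lemma Base.lc_lt (h : Base q k m N φ) {lo w : ℕ} {G : BTree → BTree} {t : BTree} (hlo : lo ≤ N)
    (ht : Valid lo t) (hG : IsCtx N lo w G) (hw : w ≤ k) (hm : MonoSub q φ G t) : t.lc < m := by
  by_contra! hlt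
  obtain ⟨c, hc⟩ := hm
  obtain ⟨D, hD, hDs, hE⟩ := exists_lcomb ht
  obtain ⟨b₀, L, hL, hLw, hb⟩ :=
    hG.col_eq_path (q := q) (φ := φ) (q + 1) false (if q = q then some ∅ else none)
  refine h.not_const (K₀ := ∅) (D := D) (K₁ := L) (lo := 0) (hi := lo) (c := c ^^ b₀) hlo (by simp)
    (fun x hx => ?_) hL (by simp; omega) (by omega) (fun E hED hq => ?_) (by omega)
  · have := Finset.mem_Icc.mp (hDs hx)
    simp; omega
  · obtain ⟨p, hp, hpE⟩ := hE E hED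
    have hs := hc p hp (by rw [hpE.size_eq, hq, size_leaf])
    rw [hb p E] at hs
    · rw [← hs, Finset.empty_union]
      cases b₀ <;> simp
    · have h3 := h.three_le
      rw [hpE.st_eq h.three_le h.vanish, combRp, hq, if_neg (by omega)]

lemma Base.rc_lt (h : Base q k m N φ) {lo w : ℕ} {G : BTree → BTree} {t : BTree} (hlo : lo ≤ N)
    (ht : Valid lo t) (hG : IsCtx N lo w G) (hw : w ≤ k) (hm : MonoSub q φ G t) : t.rc < m := by
  simpa using h.lc_lt hlo ht.mirror hG.mirror hw hm.mirror

lemma exists_rcomb {b : ℕ} {t : BTree} (ht : Valid b t) {n : ℕ} (hn : n ≤ t.rc) :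
    ∃ E p, Sub p t ∧ LComb leaf p.mirror E ∧ E.card = n := by
  obtain ⟨D, hD, -, hE⟩ := exists_lcomb ht.mirror
  obtain ⟨E, hED, hEn⟩ := Finset.exists_subset_card_eq (s := D) (n := n) (by simpa [hD] using hn)
  obtain ⟨p, hp, hpE⟩ := hE E hED
  exact ⟨E, p.mirror, by simpa using hp.mirror, by simpa using hpE, hEn⟩

lemma st_of_mirror {t : BTree} {n : ℕ} {b : Bool} {lp rp : Option (Finset ℕ)}
    (h : t.mirror.st q φ = ⟨n, b, lp, rp⟩) : t.st q φ = ⟨n, b, rp, lp⟩ := by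
  rw [← mirror_mirror t, st_mirror, h]
  rfl

lemma Base.not_long_comb_cherry (h : Base q k m N φ) {lo w : ℕ} {G : BTree → BTree} {t : BTree}
    (ht : Valid lo t) (hG : IsCtx N lo w G) (hm : MonoSub q φ G t) {a : ℕ} {l r : BTree}
    (hs : Sub (node a l r) t) (hl : q ≤ l.rc + 1) (hr : 2 ≤ r.size) : False := by
  have hq := h.three_le
  have hv := h.vanish
  have h0 : φ ∅ = false := hv ∅ (by simp; omega)
  have h1 : ∀ a, φ {a} = false := fun a => hv {a} (by simp; omega)
  obtain ⟨c, hc⟩ := hm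
  have hvl := (ht.sub hs).2.2.1
  obtain ⟨b, hb⟩ := exists_cherry hr
  obtain ⟨E₁, p₁, hp₁, hE₁, hc₁⟩ := exists_rcomb hvl (n := q - 2) (by omega)
  obtain ⟨E₂, p₂, hp₂, hE₂, hc₂⟩ := exists_rcomb hvl (n := q - 1) (by omega)
  have hs₁ := st_of_mirror (hE₁.st_eq hq hv)
  have hs₂ := st_of_mirror (hE₂.st_eq hq hv)
  have hf₁ := hv E₁ (by omega)
  have hf₂ := hv E₂ (by omega)
  have hg₁ : chi φ (combRp q E₁) = false := by
    unfold combRp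
    split_ifs <;> simp [h0, hf₁]
  have hg₂ : combRp q E₂ = none := by
    rw [combRp, if_neg (by omega), if_neg (by omega)]
  have e₁ : (node a p₁ (node b leaf leaf)).st q φ = ⟨q + 1, true, some ∅, some ∅⟩ := by
    rw [st, st_cherry hq hv, hs₁, hc₁]
    ext1
    · simp [join]; omega
    · have : q - 2 ≠ 0 := by omega
      simp [join, h1, hf₁, hg₁, this]
    · have : q - 2 ≠ 0 := by omega
      have : 2 < q := by omega
      simp [join, grow, *]
    · have : q - 2 ≠ 0 := by omega
      have : q - 2 + 1 < q := by omega
      simp [join, grow, *]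
  have e₂ : (node a p₂ leaf).st q φ = ⟨q + 1, !true, some ∅, some ∅⟩ := by
    have : q - 1 + 1 = q := by omega
    have : q ≠ 1 := by omega
    rw [st, st, hs₂, hc₂]
    ext1 <;> simp [join, grow, push, *]
  refine hG.col_ne e₁ e₂ ((hc _ (hs.trans (.node hp₁ hb)) ?_).trans
    (hc _ (hs.trans (.node hp₂ (sub_leaf r))) ?_).symm)
  · simpa using congrArg TreeState.size e₁
  · simpa using congrArg TreeState.size e₂

lemma Base.good (h : Base q k m N φ) {lo w : ℕ} {G : BTree → BTree} {t : BTree}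
    (ht : Valid lo t) (hG : IsCtx N lo w G) (hm : MonoSub q φ G t) : Good q t := by
  intro a l r hs
  refine ⟨fun h' => h.not_long_comb_cherry ht hG hm hs h'.1 h'.2, fun h' => ?_⟩
  exact h.not_long_comb_cherry ht.mirror hG.mirror hm.mirror hs.mirror (by simpa using h'.1)
    (by simpa using h'.2)

lemma Base.size_le (h : Base q k m N φ) {lo w : ℕ} {G : BTree → BTree} {t : BTree} (hlo : lo ≤ N)
    (ht : Valid lo t) (hG : IsCtx N lo w G) (hw : w ≤ k) (hm : MonoSub q φ G t) :
    t.size ≤ 4 * 4 ^ (q + 1) * m := by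
  have h₁ := h.lc_lt hlo ht hG hw hm
  have h₂ := h.rc_lt hlo ht hG hw hm
  refine (h.good ht hG hm).size_le.trans ?_
  calc 2 * 4 ^ (q + 1) * (t.lc + t.rc + 1) ≤ 2 * 4 ^ (q + 1) * (2 * m) :=
        Nat.mul_le_mul_left _ (by omega)
    _ = _ := by ring

/-- The spine with base `U` and teeth `A` hanging to the right at the levels `a`, top tooth
first. -/
def spine (U : BTree) : List (ℕ × BTree) → BTree
  | [] => U
  | (a, A) :: sp => node a (spine U sp) A

/-- The number of leaves in the teeth. -/
def total (sp : List (ℕ × BTree)) : ℕ := (sp.map fun x => x.2.size).sum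

/-- `SubSp sp' sp`: the teeth `sp'` are induced by leaves of the teeth `sp`. -/
inductive SubSp : List (ℕ × BTree) → List (ℕ × BTree) → Prop
  | nil : SubSp [] []
  | skip {sp sp' : List (ℕ × BTree)} (x : ℕ × BTree) : SubSp sp' sp → SubSp sp' (x :: sp)
  | keep {sp sp' : List (ℕ × BTree)} {A A' : BTree} (a : ℕ) : SubSp sp' sp → Sub A' A →
      SubSp ((a, A') :: sp') ((a, A) :: sp)

@[simp] lemma total_nil : total [] = 0 := rfl

@[simp] lemma total_cons (x : ℕ × BTree) (sp : List (ℕ × BTree)) :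
    total (x :: sp) = x.2.size + total sp := by
  simp [total]

lemma SubSp.of_sublist {s sp sp' : List (ℕ × BTree)} (h : SubSp s sp') (hs : sp'.Sublist sp) :
    SubSp s sp := by
  induction hs generalizing s with
  | slnil => exact h
  | cons x _ ih => exact .skip x (ih h)
  | cons_cons x _ ih =>
    cases h with
    | skip _ h => exact .skip _ (ih h)
    | keep a h hA => exact .keep a (ih h) hA

/-- All induced teeth with `q + 1` leaves in total give the same color when plugged into `G`. -/
def MonoSpine (q : ℕ) (φ : Finset ℕ → Bool) (G : BTree → BTree) (U : BTree)
    (sp : List (ℕ × BTree)) : Prop :=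
  ∃ c, ∀ sp', SubSp sp' sp → total sp' = q + 1 → (G (spine U sp')).col q φ = c

lemma exists_comb_of_spine {U : BTree} {sp : List (ℕ × BTree)} {lo : ℕ} (hsp : sp ≠ [])
    (hv : Valid lo (spine U sp)) : ∃ a D, D.card + 1 = sp.length ∧ D ⊆ Finset.Ioc a lo ∧ a ≤ lo ∧
      Valid a (node a U leaf) ∧ ∀ E ⊆ D, ∃ sp', SubSp sp' sp ∧ total sp' = E.card + 1 ∧
        LComb (node a U leaf) (spine U sp') E := by
  induction sp generalizing lo with
  | nil => exact absurd rfl hsp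
  | cons x sp ih =>
    obtain ⟨b, B⟩ := x
    obtain ⟨hb1, hb, hvU, -⟩ := hv
    rcases eq_or_ne sp [] with rfl | hne
    · refine ⟨b, ∅, rfl, by simp, hb, ⟨hb1, le_rfl, hvU, trivial⟩, fun E hE => ?_⟩
      rw [Finset.subset_empty.mp hE]
      exact ⟨[(b, leaf)], .keep b .nil (sub_leaf B), rfl, .base⟩
    · obtain ⟨a, D, hD, hDs, ha, hva, hE⟩ := ih hne hvU
      have hlt : ∀ x ∈ D, x < b := fun x hx => by
        have := Finset.mem_Ioc.mp (hDs hx)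
        omega
      refine ⟨a, insert b D, ?_, ?_, by omega, hva, fun E hED => ?_⟩
      · rw [Finset.card_insert_of_notMem fun h => (hlt _ h).false, hD, List.length_cons]
      · intro x hx
        rcases Finset.mem_insert.mp hx with rfl | hx
        · simp; omega
        · have := Finset.mem_Ioc.mp (hDs hx)
          simp; omega
      · by_cases hbE : b ∈ E
        · have hE' : E.erase b ⊆ D := by
            rw [Finset.subset_insert_iff] at hED
            exact hED
          obtain ⟨sp', hs, ht, hp⟩ := hE _ hE'
          refine ⟨(b, leaf) :: sp', .keep b hs (sub_leaf B), ?_, ?_⟩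
          · rw [total_cons, ht, ← Finset.card_erase_add_one hbE, size_leaf]
            omega
          · have := LComb.node hp fun x hx => hlt x (hE' hx)
            rwa [Finset.insert_erase hbE] at this
        · obtain ⟨sp', hs, ht, hp⟩ := hE E ((Finset.subset_insert_iff_of_notMem hbE).mp hED)
          exact ⟨sp', .skip _ hs, ht, hp⟩

lemma LComb.st_eq_of_base (h0 : φ ∅ = false) {V p : BTree} {E : Finset ℕ} (hE : LComb V p E)
    {n : ℕ} (hn : 2 ≤ n) {b : Bool} {L : Finset ℕ} {ρ : Option (Finset ℕ)}
    (hV : V.st q φ = ⟨n, b, some L, ρ⟩) (hρ : chi φ ρ = false) :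
    p.st q φ = ⟨E.card + n, b, some (L ∪ E),
      if E.card = 0 then ρ else if E.card + n = q + 1 then some ∅ else none⟩ := by
  induction hE with
  | base => simp [hV]
  | @node p E a hp hlt ih =>
    have ha : (insert a E).card = E.card + 1 :=
      Finset.card_insert_of_notMem fun h => (hlt _ h).false
    rw [st, ih]
    ext1
    · simp [join, st, ha]; omega
    · have : chi φ (if E.card = 0 then ρ else if E.card + n = q + 1 then some ∅ else none)
          = false := by
        split_ifs <;> simp [h0, hρ]
      simp [join, st, h0, -Finset.card_eq_zero, this]
    · simp [join, st, grow, push]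
    · have h₁ : E.card + n ≠ 1 := by omega
      have h₂ : E.card + n = q ↔ E.card + 1 + n = q + 1 := by omega
      simp [join, st, grow, ha, h₁, h₂]

lemma Base.length_le (h : Base q k m N φ) {lo w : ℕ} {G : BTree → BTree} {U : BTree}
    {sp : List (ℕ × BTree)} (hlo : lo ≤ N) (hv : Valid lo (spine U sp)) (hG : IsCtx N lo w G)
    (hw : U.size + w ≤ k) (hm : MonoSpine q φ G U sp) : sp.length ≤ m := by
  by_contra! hlt
  have hq := h.three_le
  have h0 : φ ∅ = false := h.vanish ∅ (by simp; omega)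
  obtain ⟨c, hc⟩ := hm
  obtain ⟨a, D, hD, hDs, ha, hva, hE⟩ := exists_comb_of_spine (sp := sp) (by
    rintro rfl
    simp at hlt) hv
  have hU := U.size_pos
  obtain ⟨L₁, hL₁⟩ : ∃ L, ((node a U leaf).st q φ).lp = some L := by
    cases hl : (U.st q φ).lp <;> simp [st, join, grow, push, hl]
  obtain ⟨ρ, hρ, hρ0⟩ : ∃ ρ, ((node a U leaf).st q φ).rp = ρ ∧ chi φ ρ = false := by
    refine ⟨_, rfl, ?_⟩
    have : φ {a} = false := h.vanish {a} (by simp; omega)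
    simp only [st, join, grow, push]
    split_ifs <;> simp [h0, this]
  have hst : (node a U leaf).st q φ =
      ⟨U.size + 1, ((node a U leaf).st q φ).bit, some L₁, ρ⟩ := by
    ext1
    · simp
    · rfl
    · exact hL₁
    · exact hρ
  obtain ⟨hLs, hLc⟩ := lp_bound q φ hva hL₁
  obtain ⟨b₀, L, hL, hLw, hb⟩ := hG.col_eq_path (q := q) (φ := φ) (q + (U.size + 1))
    ((node a U leaf).st q φ).bit none
  rw [size_node, size_leaf] at hLc
  refine h.not_const (c := c ^^ b₀) hlo hLs hDs hL (by omega) (by omega) (fun E hED hEq => ?_) ha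
  obtain ⟨sp', hs, ht, hp⟩ := hE E hED
  have hs := hc sp' hs (by rw [ht, hEq])
  rw [hb _ (L₁ ∪ E)] at hs
  · rw [← hs]
    cases b₀ <;> simp
  · rw [hp.st_eq_of_base h0 (by omega) hst hρ0, hEq, if_neg (by omega), if_neg (by omega)]

/-- Teeth containing combs with up to `q` leaves that do not contribute to the color. -/
def Heavy (q : ℕ) (φ : Finset ℕ → Bool) (A : BTree) : Prop :=
  ∀ n, 1 ≤ n → n ≤ q → ∃ p b, Sub p A ∧ p.size = n ∧ Valid b p ∧ (p.st q φ).bit = false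

lemma Base.heavy (h : Base q k m N φ) {b : ℕ} {A : BTree} (hA : Valid b A)
    (hs : 4 ^ (q + 1) ≤ A.size) : Heavy q φ A := by
  intro n h1 hn
  have hor : q + 1 ≤ A.lc ∨ q + 1 ≤ A.rc := by
    by_contra! hlt
    exact absurd (size_lt_of_comb_lt hlt.1 hlt.2) (by omega)
  rcases hor with hl | hr
  · obtain ⟨D, hD, -, hE⟩ := exists_lcomb hA
    obtain ⟨E, hED, hEn⟩ := Finset.exists_subset_card_eq (s := D) (n := n - 1) (by omega)
    obtain ⟨p, hp, hpE⟩ := hE E hED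
    exact ⟨p, b, hp, by rw [hpE.size_eq, hEn, size_leaf]; omega, hA.sub hp,
      by rw [hpE.st_eq h.three_le h.vanish]⟩
  · obtain ⟨E, p, hp, hpE, hEn⟩ := exists_rcomb hA (n := n - 1) (by omega)
    refine ⟨p, b, hp, ?_, hA.sub hp, by rw [st_of_mirror (hpE.st_eq h.three_le h.vanish)]⟩
    rw [← size_mirror, hpE.size_eq, hEn, size_leaf]
    omega

lemma Base.not_three_heavy (h : Base q k m N φ) {lo w : ℕ} {G : BTree → BTree} {U : BTree}
    {sp : List (ℕ × BTree)}
    (hG : IsCtx N lo w G) (hm : MonoSpine q φ G U sp) {a₁ a₂ a₃ : ℕ} {A₁ A₂ A₃ : BTree}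
    (hs : [(a₃, A₃), (a₂, A₂), (a₁, A₁)].Sublist sp) (h₁ : Heavy q φ A₁) (h₂ : 2 ≤ A₂.size) :
    False := by
  have hq := h.three_le
  have hv := h.vanish
  have h0 : φ ∅ = false := hv ∅ (by simp; omega)
  have hone : ∀ a, φ {a} = false := fun a => hv {a} (by simp; omega)
  obtain ⟨c, hc⟩ := hm
  obtain ⟨b, hb⟩ := exists_cherry h₂
  obtain ⟨p, β, hp, hpn, hpv, hpb⟩ := h₁ (q - 1) (by omega) (by omega)
  have hpl := chi_lp_eq_false hv hpv (by omega)
  have hpr := chi_rp_eq_false hv hpv (by omega)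
  have hps : p.st q φ = ⟨q - 1, false, (p.st q φ).lp, (p.st q φ).rp⟩ := by
    ext1 <;> simp [hpn, hpb]
  by_cases hU1 : U.size = 1
  · obtain rfl := eq_leaf_of_size hU1
    obtain ⟨p', β', hp', hpn', hpv', hpb'⟩ := h₁ (q - 2) (by omega) (by omega)
    have hpl' := chi_lp_eq_false hv hpv' (by omega)
    have hpr' := chi_rp_eq_false hv hpv' (by omega)
    have hps' : p'.st q φ = ⟨q - 2, false, (p'.st q φ).lp, (p'.st q φ).rp⟩ := by
      ext1 <;> simp [hpn', hpb']
    have hpush : ∀ t : BTree, ∀ b, Valid b t → t.size < q →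
        chi φ (push a₁ (t.st q φ).rp) = false := by
      intro t b ht hlt
      cases hl : (t.st q φ).rp with
      | none => exact h0
      | some S =>
        have := rp_bound q φ ht hl
        have := Finset.card_insert_le a₁ S
        exact hv _ (by omega)
    have hpp := hpush p β hpv (by omega)
    have hpp' := hpush p' β' hpv' (by omega)
    have n₁ : q - 1 ≠ 1 := by omega
    have n₂ : 1 + (q - 1) = q := by omega
    have n₃ : q ≠ 1 := by omega
    have n₄ : q - 1 ≠ q := by omega
    have e₁ : (node a₃ (node a₂ (node a₁ leaf p) leaf) leaf).st q φ =
        ⟨q + 2, false, some {a₃}, none⟩ := by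
      have s₁ : (node a₁ leaf p).st q φ = ⟨q, false, none, push a₁ (p.st q φ).rp⟩ := by
        rw [st, hps, st]
        ext1 <;> simp [join, grow, hpl, h0, n₁, n₂, n₄]
      have s₂ : (node a₂ (node a₁ leaf p) leaf).st q φ = ⟨q + 1, false, some ∅, some ∅⟩ := by
        rw [st, s₁, st]
        ext1 <;> simp [join, grow, h0, hpp, n₃]
      rw [st, s₂, st]
      ext1 <;> simp [join, grow, push, h0]; omega
    have e₂ : (node a₃ (node a₂ (node a₁ leaf p') (node b leaf leaf)) leaf).st q φ =
        ⟨q + 2, !false, some {a₃}, none⟩ := by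
      obtain ⟨l, s₁, hl⟩ : ∃ l, (node a₁ leaf p').st q φ =
          ⟨q - 1, false, l, push a₁ (p'.st q φ).rp⟩ ∧ chi φ l = false := by
        refine ⟨grow q a₁ 1 (some ∅) (q - 2), ?_, ?_⟩
        · rw [st, hps', st]
          ext1 <;> simp [join, grow, hpl', h0]
          omega
        · unfold grow push
          split_ifs <;> simp [h0, hone]
      have m₁ : 2 < q := by omega
      have m₂ : q - 1 < q := by omega
      have s₂ : (node a₂ (node a₁ leaf p') (node b leaf leaf)).st q φ =
          ⟨q + 1, true, some ∅, some ∅⟩ := by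
        rw [st, s₁, st_cherry hq hv]
        ext1 <;> simp [join, grow, hl, hone, hpp', n₁, m₁, m₂]
        omega
      rw [st, s₂, st]
      ext1 <;> simp [join, grow, push, h0]; omega
    refine hG.col_ne e₁ e₂ ((hc [(a₃, leaf), (a₂, leaf), (a₁, p)] ?_ ?_).trans
      (hc [(a₃, leaf), (a₂, node b leaf leaf), (a₁, p')] ?_ ?_).symm)
    · exact (SubSp.keep a₃ (.keep a₂ (.keep a₁ .nil hp) (sub_leaf _))
        (sub_leaf _)).of_sublist hs
    · simp; omega
    · exact (SubSp.keep a₃ (.keep a₂ (.keep a₁ .nil hp') hb) (sub_leaf _)).of_sublist hs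
    · simp; omega
  · obtain ⟨p', β', hp', hpn', hpv', hpb'⟩ := h₁ q (by omega) (by omega)
    have hpl' := chi_lp_eq_false hv hpv' (by omega)
    have hpr' := chi_rp_eq_false hv hpv' (by omega)
    have hps' : p'.st q φ = ⟨q, false, (p'.st q φ).lp, (p'.st q φ).rp⟩ := by
      ext1 <;> simp [hpn', hpb']
    have hU2 := U.size_pos
    have n₁ : q - 1 ≠ 1 := by omega
    have n₂ : q ≠ 1 := by omega
    have n₃ : q - 1 < q := by omega
    have n₄ : 2 < q := by omega
    have n₅ : U.size + (q - 1) ≠ 1 := by omega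
    have n₆ : U.size + q ≠ 1 := by omega
    have n₇ : ¬ U.size + (q - 1) < q := by omega
    have n₈ : U.size ≠ 0 := by omega
    set ρ : Option (Finset ℕ) := if U.size < q then some ∅ else none with hρ
    have hρ0 : chi φ ρ = false := by
      rw [hρ]
      split_ifs <;> simp [h0]
    set B : Bool := (U.st q φ).bit ^^ true ^^ chi φ (U.st q φ).rp ^^ chi φ (U.st q φ).lp with hB
    have s₁ : (node a₁ U p).st q φ = ⟨U.size + (q - 1), B, some ∅, ρ⟩ := by
      rw [st, hps]
      ext1 <;> simp [join, grow, hpl, hpr, n₁, n₃, hU1, hB, hρ]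
    have s₂ : (node a₁ U p').st q φ = ⟨U.size + q, B, none, ρ⟩ := by
      rw [st, hps']
      ext1 <;> simp [join, grow, hpl', hpr', n₂, hU1, hB, hρ]
    have e₁ : (node a₂ (node a₁ U p) (node b leaf leaf)).st q φ =
        ⟨U.size + q + 1, !B, some ∅, none⟩ := by
      rw [st, s₁, st_cherry hq hv]
      ext1
      · simp [join]; omega
      · simp [join, h0, hone, hρ0, n₅]
      · simp [join, grow, n₅, n₄]
      · simp [join, grow, n₅, n₇]
    have e₂ : (node a₂ (node a₁ U p') leaf).st q φ = ⟨U.size + q + 1, B, some ∅, none⟩ := by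
      rw [st, s₂, st]
      ext1
      · simp [join]
      · simp [join, h0, hρ0]
      · simp [join, grow, push]
      · simp [join, grow, n₆, n₈]
    refine hG.col_ne e₂ e₁ ((hc [(a₂, leaf), (a₁, p')] ?_ ?_).trans
      (hc [(a₂, node b leaf leaf), (a₁, p)] ?_ ?_).symm)
    · exact (SubSp.skip _ (.keep a₂ (.keep a₁ .nil hp') (sub_leaf _))).of_sublist hs
    · simp; omega
    · exact (SubSp.skip _ (.keep a₂ (.keep a₁ .nil hp) hb)).of_sublist hs
    · simp; omega

lemma valid_of_mem_spine {U : BTree} {sp : List (ℕ × BTree)} {lo : ℕ} (hv : Valid lo (spine U sp))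
    {x : ℕ × BTree} (hx : x ∈ sp) : 1 ≤ x.1 ∧ x.1 ≤ lo ∧ Valid (x.1 - 1) x.2 := by
  induction sp generalizing lo with
  | nil => simp at hx
  | cons y sp ih =>
    obtain ⟨h1, h2, h3, h4⟩ := hv
    rcases List.mem_cons.mp hx with rfl | hx
    · exact ⟨h1, h2, h4⟩
    · obtain ⟨e1, e2, e3⟩ := ih h3 hx
      exact ⟨e1, by omega, e3⟩

lemma total_le_of_filter {sp : List (ℕ × BTree)} (C α : ℕ) (h : ∀ x ∈ sp, x.2.size ≤ α) :
    total sp ≤ C * sp.length + α * (sp.filter fun x => C ≤ x.2.size).length := by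
  induction sp with
  | nil => simp
  | cons x sp ih =>
    have ih := ih fun y hy => h y (List.mem_cons_of_mem _ hy)
    have hx := h x List.mem_cons_self
    rw [total_cons, List.length_cons, mul_add, List.filter_cons]
    split_ifs with hC
    · rw [List.length_cons, mul_add]
      omega
    · simp only [decide_eq_true_eq] at hC
      omega

lemma Base.total_le (h : Base q k m N φ) {lo w : ℕ} {G : BTree → BTree} {U : BTree}
    {sp : List (ℕ × BTree)} (hlo : lo ≤ N) (hv : Valid lo (spine U sp)) (hG : IsCtx N lo w G)
    (hw : U.size + w ≤ k) (hm : MonoSpine q φ G U sp) : total sp ≤ 9 * 4 ^ (q + 1) * m := by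
  have hα : ∀ x ∈ sp, x.2.size ≤ 4 * 4 ^ (q + 1) * m := by
    intro x hx
    obtain ⟨h1, h2, h3⟩ := valid_of_mem_spine hv hx
    refine h.size_le (by omega) h3 (.right U (by omega) (by omega) (hG.anti h2)) (by omega) ?_
    obtain ⟨c, hc⟩ := hm
    exact ⟨c, fun p hp hs => hc [(x.1, p)]
      ((SubSp.keep x.1 .nil hp).of_sublist (List.singleton_sublist.mpr hx)) (by simpa using hs)⟩
  have hlen := h.length_le hlo hv hG hw hm
  have htot := total_le_of_filter (4 ^ (q + 1)) _ hα
  have hmem : ∀ x ∈ sp.filter fun x => 4 ^ (q + 1) ≤ x.2.size,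
      x ∈ sp ∧ 4 ^ (q + 1) ≤ x.2.size := by
    simp
  have hsub : (sp.filter fun x => 4 ^ (q + 1) ≤ x.2.size).Sublist sp := List.filter_sublist
  have hfil : (sp.filter fun x => 4 ^ (q + 1) ≤ x.2.size).length ≤ 2 := by
    match hf : sp.filter fun x => 4 ^ (q + 1) ≤ x.2.size with
    | [] => simp [hf]
    | [x] => simp [hf]
    | [x, y] => simp [hf]
    | x :: y :: z :: l =>
      rw [hf] at hmem hsub
      have hy := hmem y (by simp)
      have hz := hmem z (by simp)
      have : 4 ^ 1 ≤ 4 ^ (q + 1) := Nat.pow_le_pow_right (by norm_num) (by omega)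
      refine (h.not_three_heavy hG hm (((List.nil_sublist l).cons_cons z |>.cons_cons y
        |>.cons_cons x).trans hsub) (h.heavy (valid_of_mem_spine hv hz.1).2.2 hz.2) ?_).elim
      omega
  have h₁ : 4 ^ (q + 1) * sp.length ≤ 4 ^ (q + 1) * m := Nat.mul_le_mul_left _ hlen
  have h₂ := Nat.mul_le_mul_left (4 * 4 ^ (q + 1) * m) hfil
  calc total sp ≤ 4 ^ (q + 1) * m + 4 * 4 ^ (q + 1) * m * 2 := htot.trans (by omega)
    _ = _ := by ring

/-- The node whose first child is on the left, or on the right if `d` is true. -/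
def nodeD (d : Bool) (a : ℕ) (s t : BTree) : BTree :=
  if d then node a t s else node a s t

/-- The spine whose teeth hang to the right, or to the left if `d` is true. -/
def spineD (d : Bool) (U : BTree) : List (ℕ × BTree) → BTree
  | [] => U
  | (a, A) :: sp => nodeD d a (spineD d U sp) A

lemma spineD_false (U : BTree) (sp : List (ℕ × BTree)) : spineD false U sp = spine U sp := by
  induction sp with
  | nil => rfl
  | cons x sp ih => simp [spineD, spine, nodeD, ih]

lemma spineD_true (U : BTree) (sp : List (ℕ × BTree)) :
    (spineD true U sp).mirror = spine U.mirror (sp.map fun x => (x.1, x.2.mirror)) := by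
  induction sp with
  | nil => rfl
  | cons x sp ih => simp [spineD, spine, nodeD, mirror, ih]

lemma total_map_mirror (sp : List (ℕ × BTree)) :
    total (sp.map fun x => (x.1, x.2.mirror)) = total sp := by
  induction sp with
  | nil => rfl
  | cons x sp ih => simp [ih]

lemma SubSp.map_mirror {sp sp' : List (ℕ × BTree)} (h : SubSp sp' sp) :
    SubSp (sp'.map fun x => (x.1, x.2.mirror)) (sp.map fun x => (x.1, x.2.mirror)) := by
  induction h with
  | nil => exact .nil
  | skip x _ ih => exact .skip _ ih
  | keep a _ hA ih => exact .keep a ih hA.mirror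

lemma Base.total_le_spineD (h : Base q k m N φ) (d : Bool) {lo w : ℕ} {G : BTree → BTree}
    {U : BTree} {sp : List (ℕ × BTree)} (hlo : lo ≤ N) (hv : Valid lo (spineD d U sp))
    (hG : IsCtx N lo w G) (hw : U.size + w ≤ k) {c : Bool}
    (hc : ∀ sp', SubSp sp' sp → total sp' = q + 1 → (G (spineD d U sp')).col q φ = c) :
    total sp ≤ 9 * 4 ^ (q + 1) * m := by
  cases d with
  | false =>
    simp only [spineD_false] at hv hc
    exact h.total_le hlo hv hG hw ⟨c, hc⟩
  | true =>
    rw [← total_map_mirror]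
    refine h.total_le (U := U.mirror) hlo ?_ hG.mirror (by simpa using hw)
      ⟨c, fun sp' hs ht => ?_⟩
    · rw [← spineD_true]
      exact hv.mirror
    · have hm : (sp'.map fun x : ℕ × BTree => (x.1, x.2.mirror)).map
          (fun x => (x.1, x.2.mirror)) = sp' := by
        simp [Function.comp_def]
      have hs' := hs.map_mirror
      have hid : (sp.map fun x : ℕ × BTree => (x.1, x.2.mirror)).map
          (fun x => (x.1, x.2.mirror)) = sp := by
        simp [Function.comp_def]
      rw [hid] at hs'
      have := hc _ hs' (by rw [total_map_mirror, ht])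
      rw [col_mirror, ← this]
      congr 2
      rw [← mirror_mirror (spineD true U _), spineD_true, hm]

/-- The dyadic interval of length `2 ^ ℓ` that starts at `b`. -/
def block (ℓ b : ℕ) : Finset ℕ := Finset.Ico b (b + 2 ^ ℓ)

/-- The start of the left half of a dyadic interval, or of its right half if `d` is true. -/
def half (d : Bool) (ℓ b : ℕ) : ℕ := if d then b + 2 ^ ℓ else b

/-- Joins two optional trees at a node of level `a`. -/
def optNode (d : Bool) (a : ℕ) : Option BTree → Option BTree → Option BTree
  | none, t => t
  | some s, none => some s
  | some s, some t => some (nodeD d a s t)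

/-- The tree of the dyadic splits of `X` in the interval of length `2 ^ ℓ` that starts at `b`. -/
def ofSet (X : Finset ℕ) : ℕ → ℕ → Option BTree
  | 0, b => if b ∈ X then some leaf else none
  | ℓ + 1, b => optNode false (ℓ + 1) (ofSet X ℓ b) (ofSet X ℓ (b + 2 ^ ℓ))

lemma ofSet_succ (X : Finset ℕ) (d : Bool) (ℓ b : ℕ) : ofSet X (ℓ + 1) b =
    optNode d (ℓ + 1) (ofSet X ℓ (half d ℓ b)) (ofSet X ℓ (half (!d) ℓ b)) := by
  cases d with
  | false => rfl
  | true =>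
    simp only [ofSet, half, if_true, Bool.not_true, Bool.false_eq_true, if_false]
    cases ofSet X ℓ b <;> cases ofSet X ℓ (b + 2 ^ ℓ) <;> rfl

lemma mem_block {ℓ b x : ℕ} : x ∈ block ℓ b ↔ b ≤ x ∧ x < b + 2 ^ ℓ := Finset.mem_Ico

lemma mem_block_succ (d : Bool) {ℓ b x : ℕ} :
    x ∈ block (ℓ + 1) b ↔ x ∈ block ℓ (half d ℓ b) ∨ x ∈ block ℓ (half (!d) ℓ b) := by
  have : 0 < 2 ^ ℓ := by positivity
  simp only [mem_block, pow_succ]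
  cases d <;> simp only [half, Bool.not_true, Bool.not_false, Bool.false_eq_true, if_true,
    if_false] <;> omega

lemma notMem_block_half (d : Bool) {ℓ b x : ℕ} (h : x ∈ block ℓ (half d ℓ b)) :
    x ∉ block ℓ (half (!d) ℓ b) := by
  have : 0 < 2 ^ ℓ := by positivity
  simp only [mem_block] at *
  cases d <;> simp only [half, Bool.not_true, Bool.not_false, Bool.false_eq_true, if_true,
    if_false] at * <;> omega

lemma inter_block_succ (X : Finset ℕ) (d : Bool) (ℓ b : ℕ) : X ∩ block (ℓ + 1) b =
    X ∩ block ℓ (half d ℓ b) ∪ X ∩ block ℓ (half (!d) ℓ b) := by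
  ext x
  simp only [Finset.mem_inter, Finset.mem_union, mem_block_succ d]
  tauto

lemma card_inter_block_succ (X : Finset ℕ) (d : Bool) (ℓ b : ℕ) : (X ∩ block (ℓ + 1) b).card =
    (X ∩ block ℓ (half d ℓ b)).card + (X ∩ block ℓ (half (!d) ℓ b)).card := by
  rw [inter_block_succ X d, Finset.card_union_of_disjoint]
  exact Finset.disjoint_left.mpr fun x hx hx' =>
    notMem_block_half d (Finset.mem_inter.mp hx).2 (Finset.mem_inter.mp hx').2

lemma ofSet_congr {X Y : Finset ℕ} {ℓ b : ℕ} (h : X ∩ block ℓ b = Y ∩ block ℓ b) :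
    ofSet X ℓ b = ofSet Y ℓ b := by
  have h : ∀ x ∈ block ℓ b, x ∈ X ↔ x ∈ Y := fun x hx => by
    simpa [hx] using Finset.ext_iff.mp h x
  induction ℓ generalizing b with
  | zero => simp [ofSet, h b (by simp [mem_block])]
  | succ ℓ ih =>
    have hd : ∀ d, ofSet X ℓ (half d ℓ b) = ofSet Y ℓ (half d ℓ b) := fun d =>
      have hd : ∀ x ∈ block ℓ (half d ℓ b), x ∈ X ↔ x ∈ Y :=
        fun x hx => h x ((mem_block_succ d).mpr (.inl hx))
      ih (by ext x; simp only [Finset.mem_inter]; specialize hd x; tauto) hd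
    rw [ofSet_succ X false, ofSet_succ Y false, hd, hd]

lemma ofSet_eq_none {X : Finset ℕ} {ℓ b : ℕ} : ofSet X ℓ b = none ↔ X ∩ block ℓ b = ∅ := by
  induction ℓ generalizing b with
  | zero =>
    have : block 0 b = {b} := by ext; simp only [mem_block, Finset.mem_singleton]; omega
    by_cases hb : b ∈ X <;> simp [ofSet, this, hb]
  | succ ℓ ih =>
    rw [ofSet_succ X false, inter_block_succ X false, Finset.union_eq_empty, ← ih, ← ih]
    cases ofSet X ℓ (half false ℓ b) <;> cases ofSet X ℓ (half (!false) ℓ b) <;> simp [optNode]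

lemma size_ofSet {X : Finset ℕ} {ℓ b : ℕ} {t : BTree} (h : ofSet X ℓ b = some t) :
    t.size = (X ∩ block ℓ b).card := by
  induction ℓ generalizing b t with
  | zero =>
    have : block 0 b = {b} := by ext; simp only [mem_block, Finset.mem_singleton]; omega
    by_cases hb : b ∈ X
    · simp [ofSet, hb] at h
      simp [← h, this, hb]
    · simp [ofSet, hb] at h
  | succ ℓ ih =>
    rw [card_inter_block_succ X false]
    rw [ofSet_succ X false] at h
    cases h₁ : ofSet X ℓ (half false ℓ b) with
    | none =>
      rw [ofSet_eq_none.mp h₁]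
      rw [h₁, optNode] at h
      simpa using ih h
    | some s =>
      cases h₂ : ofSet X ℓ (half (!false) ℓ b) with
      | none =>
        rw [ofSet_eq_none.mp h₂]
        rw [h₁, h₂, optNode, ← h₁] at h
        simpa using ih h
      | some s' =>
        rw [h₁, h₂, optNode, Option.some_inj] at h
        rw [← ih h₁, ← ih h₂, ← h]
        rfl

lemma valid_ofSet {X : Finset ℕ} {ℓ b : ℕ} {t : BTree} (h : ofSet X ℓ b = some t) :
    Valid ℓ t := by
  induction ℓ generalizing b t with
  | zero =>
    by_cases hb : b ∈ X
    · simp [ofSet, hb] at h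
      simp [← h, Valid]
    · simp [ofSet, hb] at h
  | succ ℓ ih =>
    rw [ofSet_succ X false] at h
    cases h₁ : ofSet X ℓ (half false ℓ b) with
    | none =>
      rw [h₁, optNode] at h
      exact (ih h).mono (Nat.le_succ ℓ)
    | some s =>
      cases h₂ : ofSet X ℓ (half (!false) ℓ b) with
      | none =>
        rw [h₁, h₂, optNode, ← h₁] at h
        exact (ih h).mono (Nat.le_succ ℓ)
      | some s' =>
        rw [h₁, h₂, optNode, Option.some_inj] at h
        rw [← h]
        exact ⟨by omega, le_rfl, ih h₁, ih h₂⟩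

lemma ofSet_half_union (P : Finset ℕ) {Q : Finset ℕ} (d : Bool) {ℓ b : ℕ}
    (hQ : Q ⊆ block ℓ (half (!d) ℓ b)) :
    ofSet (P ∪ Q) ℓ (half d ℓ b) = ofSet P ℓ (half d ℓ b) := by
  refine ofSet_congr ?_
  ext x
  simp only [Finset.mem_inter, Finset.mem_union]
  have := notMem_block_half d (ℓ := ℓ) (b := b) (x := x)
  have := @hQ x
  tauto

lemma exists_ofSet_of_sub {X : Finset ℕ} {ℓ b : ℕ} {p t : BTree} (h : ofSet X ℓ b = some t)
    (hp : Sub p t) : ∃ P ⊆ X ∩ block ℓ b, ofSet P ℓ b = some p := by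
  induction ℓ generalizing b p t with
  | zero =>
    by_cases hb : b ∈ X
    · simp [ofSet, hb] at h
      rw [← h] at hp
      cases hp
      exact ⟨{b}, by simp [hb, mem_block], by simp [ofSet]⟩
    · simp [ofSet, hb] at h
  | succ ℓ ih =>
    rw [ofSet_succ X false] at h
    have hlift : ∀ d s, ofSet X ℓ (half d ℓ b) = some s → Sub p s →
        ∃ P ⊆ X ∩ block (ℓ + 1) b, ofSet P (ℓ + 1) b = some p := by
      intro d s hs hps
      obtain ⟨P, hP, hPp⟩ := ih hs hps
      refine ⟨P, ?_, ?_⟩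
      · rw [inter_block_succ X d]
        exact hP.trans Finset.subset_union_left
      · have hn : ofSet P ℓ (half (!d) ℓ b) = none := by
          rw [ofSet_eq_none, Finset.eq_empty_iff_forall_notMem]
          intro x hx
          rw [Finset.mem_inter] at hx
          exact notMem_block_half d (Finset.mem_inter.mp (hP hx.1)).2 hx.2
        rw [ofSet_succ P d, hPp, hn, optNode]
    cases h₁ : ofSet X ℓ (half false ℓ b) with
    | none =>
      rw [h₁, optNode] at h
      exact hlift _ _ h hp
    | some s =>
      cases h₂ : ofSet X ℓ (half (!false) ℓ b) with
      | none =>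
        rw [h₁, h₂, optNode, Option.some_inj] at h
        exact hlift _ _ h₁ (h ▸ hp)
      | some s' =>
        rw [h₁, h₂, optNode, Option.some_inj] at h
        rw [← h, nodeD, if_neg (by simp)] at hp
        cases hp with
        | left hp => exact hlift _ _ h₁ hp
        | right hp => exact hlift _ _ h₂ hp
        | node hp hp' =>
          obtain ⟨P, hP, hPp⟩ := ih h₁ hp
          obtain ⟨Q, hQ, hQp⟩ := ih h₂ hp'
          refine ⟨P ∪ Q, ?_, ?_⟩
          · rw [inter_block_succ X false]
            exact Finset.union_subset_union hP hQ
          · have hP' := hP.trans Finset.inter_subset_right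
            have hQ' := hQ.trans Finset.inter_subset_right
            rw [ofSet_succ _ false, ofSet_half_union P false hQ', Finset.union_comm,
              ofSet_half_union Q (!false) hP', hPp, hQp]
            rfl

lemma ofSet_succ_of_inter_eq_empty {X : Finset ℕ} (d : Bool) {ℓ b : ℕ}
    (h : X ∩ block ℓ (half (!d) ℓ b) = ∅) : ofSet X (ℓ + 1) b = ofSet X ℓ (half d ℓ b) := by
  rw [ofSet_succ X d, ofSet_eq_none.mpr h]
  cases ofSet X ℓ (half d ℓ b) <;> rfl

lemma block_half_lt (d : Bool) {ℓ b x y : ℕ} (hx : x ∈ block ℓ (half d ℓ b))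
    (hy : y ∈ block ℓ (half (!d) ℓ b)) : if d then y < x else x < y := by
  simp only [mem_block] at hx hy
  cases d <;> simp only [half, Bool.not_true, Bool.not_false, Bool.false_eq_true, if_true,
    if_false] at * <;> omega

lemma inter_block_half_subset (X : Finset ℕ) (d : Bool) (ℓ b : ℕ) :
    X ∩ block ℓ (half d ℓ b) ⊆ X ∩ block (ℓ + 1) b := by
  rw [inter_block_succ X d]
  exact Finset.subset_union_left

lemma IsCtx.nodeD {lo ℓ w : ℕ} {G : BTree → BTree} (h : IsCtx N ℓ w G) (d : Bool) (s : BTree)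
    (hlo : lo < ℓ) (hℓ : ℓ ≤ N) :
    IsCtx N lo (w + s.size) fun t => G (nodeD d ℓ t s) := by
  cases d with
  | false => exact .left s hlo hℓ h
  | true => exact .right s hlo hℓ h

/-- The `(q + 1)`-subsets of `M` all give the color `c` when they are added to the part of `K` in a
dyadic interval and the tree of the result is plugged into a fixed context. -/
def Hole (q : ℕ) (φ : Finset ℕ → Bool) (N k : ℕ) (c : Bool) (K M : Finset ℕ) (ℓ b : ℕ) : Prop :=
  ℓ ≤ N ∧ M ⊆ block ℓ b ∧ ∃ w G, IsCtx N ℓ w G ∧ (K ∩ block ℓ b).card + w ≤ k ∧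
    ∀ P ⊆ M, P.card = q + 1 → ∀ t, ofSet (K ∪ P) ℓ b = some t → (G t).col q φ = c

variable {c : Bool} {K M : Finset ℕ} {ℓ b : ℕ}

lemma Hole.descend (h : Hole q φ N k c K M (ℓ + 1) b) (d : Bool) {M' : Finset ℕ} (hM : M' ⊆ M)
    (hM' : M' ⊆ block ℓ (half d ℓ b)) : Hole q φ N k c K M' ℓ (half d ℓ b) := by
  obtain ⟨hℓ, -, w, G, hG, hw, hc⟩ := h
  rw [card_inter_block_succ K d] at hw
  have hfar : ∀ P ⊆ M', ofSet (K ∪ P) ℓ (half (!d) ℓ b) = ofSet K ℓ (half (!d) ℓ b) :=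
    fun P hP => ofSet_half_union K (!d) (by simpa using hP.trans hM')
  refine ⟨by omega, hM', ?_⟩
  cases hs : ofSet K ℓ (half (!d) ℓ b) with
  | none =>
    refine ⟨w, G, hG.anti (by omega), by omega, fun P hP hq t ht => hc P (hP.trans hM) hq t ?_⟩
    rw [ofSet_succ _ d, hfar P hP, ht, hs, optNode]
  | some s =>
    refine ⟨_, _, hG.nodeD d s (Nat.lt_succ_self ℓ) hℓ, ?_,
      fun P hP hq t ht => hc P (hP.trans hM) hq _ ?_⟩
    · rw [size_ofSet hs]
      omega
    · rw [ofSet_succ _ d, hfar P hP, ht, hs, optNode]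

lemma Base.card_le_of_inter_eq_empty (hB : Base q k m N φ) (h : Hole q φ N k c K M ℓ b)
    (hK : K ∩ block ℓ b = ∅) : M.card ≤ 4 * 4 ^ (q + 1) * m := by
  obtain ⟨hℓ, hM, w, G, hG, hw, hc⟩ := h
  cases ht : ofSet M ℓ b with
  | none =>
    rw [ofSet_eq_none, Finset.inter_eq_left.mpr hM] at ht
    simp [ht]
  | some t =>
    have hs := size_ofSet ht
    rw [Finset.inter_eq_left.mpr hM] at hs
    rw [← hs]
    refine hB.size_le hℓ (valid_ofSet ht) hG (by omega) ⟨c, fun p hp hq => ?_⟩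
    obtain ⟨P, hP, hPp⟩ := exists_ofSet_of_sub ht hp
    have hPs := size_ofSet hPp
    rw [Finset.inter_eq_left.mpr (hP.trans Finset.inter_subset_right)] at hPs
    refine hc P (hP.trans Finset.inter_subset_left) (by omega) p ?_
    rw [← hPp]
    refine ofSet_congr ?_
    rw [Finset.union_inter_distrib_right, hK, Finset.empty_union]

lemma exists_trivial_spine (d : Bool) (hK : (K ∩ block ℓ b).Nonempty)
    (h : M = ∅ ∨ ∃ ℓ' b', Hole q φ N k c K M ℓ' b' ∧ K ∩ block ℓ' b' ⊂ K ∩ block ℓ b) :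
    ∃ M₁ U sp, M₁ ⊆ M ∧ M.card ≤ M₁.card + total sp ∧ U.size = (K ∩ block ℓ b).card ∧
      Valid ℓ (spineD d U sp) ∧
      (∀ sp', SubSp sp' sp → ∃ P ⊆ M, P.card = total sp' ∧
        ofSet (K ∪ P) ℓ b = some (spineD d U sp')) ∧
      (M₁ = ∅ ∨ ∃ ℓ' b', Hole q φ N k c K M₁ ℓ' b' ∧ K ∩ block ℓ' b' ⊂ K ∩ block ℓ b) := by
  cases hU : ofSet K ℓ b with
  | none =>
    rw [ofSet_eq_none.mp hU] at hK
    exact absurd hK Finset.not_nonempty_empty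
  | some U =>
    refine ⟨M, U, [], subset_rfl, by simp, size_ofSet hU, valid_ofSet hU, fun sp' hs => ?_, h⟩
    cases hs
    exact ⟨∅, Finset.empty_subset M, rfl, by rw [Finset.union_empty, hU]; rfl⟩

lemma Hole.exists_spine (d : Bool) (h : Hole q φ N k c K M ℓ b) (hK : (K ∩ block ℓ b).Nonempty)
    (hs : ∀ x ∈ K ∩ block ℓ b, ∀ y ∈ M, if d then y < x else x < y) :
    ∃ M₁ U sp, M₁ ⊆ M ∧ M.card ≤ M₁.card + total sp ∧ U.size = (K ∩ block ℓ b).card ∧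
      Valid ℓ (spineD d U sp) ∧
      (∀ sp', SubSp sp' sp → ∃ P ⊆ M, P.card = total sp' ∧
        ofSet (K ∪ P) ℓ b = some (spineD d U sp')) ∧
      (M₁ = ∅ ∨ ∃ ℓ' b', Hole q φ N k c K M₁ ℓ' b' ∧ K ∩ block ℓ' b' ⊂ K ∩ block ℓ b) := by
  induction ℓ generalizing b M with
  | zero =>
    refine exists_trivial_spine d hK (.inl (Finset.eq_empty_of_forall_notMem fun y hy => ?_))
    obtain ⟨x, hx⟩ := hK
    have hxy := hs x hx y hy
    have hx := mem_block.mp (Finset.mem_inter.mp hx).2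
    have hy := mem_block.mp (h.2.1 hy)
    cases d <;> simp at hxy <;> omega
  | succ ℓ ih =>
    by_cases hfar : (K ∩ block ℓ (half (!d) ℓ b)).Nonempty
    · have hM : M ⊆ block ℓ (half (!d) ℓ b) := by
        intro y hy
        obtain ⟨x, hx⟩ := hfar
        refine ((mem_block_succ d).mp (h.2.1 hy)).resolve_left fun hy' => ?_
        have h₁ := block_half_lt d hy' (Finset.mem_inter.mp hx).2
        have h₂ := hs x (inter_block_half_subset K (!d) ℓ b hx) y hy
        cases d <;> simp at h₁ h₂ <;> omega
      have hd := h.descend (!d) subset_rfl hM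
      by_cases hnear : (K ∩ block ℓ (half d ℓ b)).Nonempty
      · refine exists_trivial_spine d hK (.inr ⟨_, _, hd,
          (Finset.ssubset_iff_of_subset (inter_block_half_subset K (!d) ℓ b)).mpr ?_⟩)
        obtain ⟨x, hx⟩ := hnear
        exact ⟨x, inter_block_half_subset K d ℓ b hx, fun hx' =>
          notMem_block_half d (Finset.mem_inter.mp hx).2 (Finset.mem_inter.mp hx').2⟩
      · rw [Finset.not_nonempty_iff_eq_empty] at hnear
        have hKeq : K ∩ block (ℓ + 1) b = K ∩ block ℓ (half (!d) ℓ b) := by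
          rw [inter_block_succ K d, hnear, Finset.empty_union]
        obtain ⟨M₁, U, sp, h1, h2, h3, h4, h5, h6⟩ := ih hd hfar (by rwa [← hKeq])
        rw [hKeq]
        refine ⟨M₁, U, sp, h1, h2, h3, h4.mono (Nat.le_succ ℓ), fun sp' hsp => ?_, h6⟩
        obtain ⟨P, hP, hPc, hPt⟩ := h5 sp' hsp
        refine ⟨P, hP, hPc, ?_⟩
        rw [ofSet_succ_of_inter_eq_empty (!d), hPt]
        rw [Bool.not_not, ← ofSet_eq_none, ofSet_half_union K d (hP.trans hM), ofSet_eq_none, hnear]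
    · rw [Finset.not_nonempty_iff_eq_empty] at hfar
      have hKeq : K ∩ block (ℓ + 1) b = K ∩ block ℓ (half d ℓ b) := by
        rw [inter_block_succ K d, hfar, Finset.union_empty]
      have hnear := hK
      rw [hKeq] at hnear
      have hd := h.descend d Finset.inter_subset_left
        (Finset.inter_subset_right (s₁ := M) (s₂ := block ℓ (half d ℓ b)))
      obtain ⟨M₁, U, sp, h1, h2, h3, h4, h5, h6⟩ := ih hd hnear
        fun x hx y hy => hs x (hKeq ▸ hx) y (Finset.inter_subset_left hy)
      have hMc := card_inter_block_succ M d ℓ b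
      rw [Finset.inter_eq_left.mpr h.2.1] at hMc
      rw [hKeq]
      have hstep : ∀ sp', SubSp sp' sp → ∃ P ⊆ M, P.card = total sp' ∧
          ofSet (K ∪ P) (ℓ + 1) b = some (spineD d U sp') := by
        intro sp' hsp
        obtain ⟨P, hP, hPc, hPt⟩ := h5 sp' hsp
        refine ⟨P, hP.trans Finset.inter_subset_left, hPc, ?_⟩
        rw [ofSet_succ_of_inter_eq_empty d, hPt]
        rw [← ofSet_eq_none, ofSet_half_union K (!d), ofSet_eq_none, hfar]
        rw [Bool.not_not]
        exact hP.trans Finset.inter_subset_right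
      cases hA : ofSet M ℓ (half (!d) ℓ b) with
      | none =>
        rw [ofSet_eq_none.mp hA, Finset.card_empty, add_zero] at hMc
        exact ⟨M₁, U, sp, h1.trans Finset.inter_subset_left, hMc ▸ h2, h3, h4.mono (Nat.le_succ ℓ),
          hstep, h6⟩
      | some A =>
        refine ⟨M₁, U, (ℓ + 1, A) :: sp, h1.trans Finset.inter_subset_left, ?_, h3, ?_, ?_, h6⟩
        · rw [total_cons, size_ofSet hA]
          omega
        · have := valid_ofSet hA
          cases d
          · exact ⟨by omega, le_rfl, h4, this⟩
          · exact ⟨by omega, le_rfl, this, h4⟩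
        · intro sp' hsp
          cases hsp with
          | skip _ hsp => exact hstep _ hsp
          | keep _ hsp hA' =>
            obtain ⟨P, hP, hPc, hPt⟩ := h5 _ hsp
            obtain ⟨Q, hQ, hQt⟩ := exists_ofSet_of_sub hA hA'
            have hP' := hP.trans Finset.inter_subset_right
            have hQ' := hQ.trans Finset.inter_subset_right
            refine ⟨P ∪ Q, Finset.union_subset (hP.trans Finset.inter_subset_left)
              (hQ.trans Finset.inter_subset_left), ?_, ?_⟩
            · rw [Finset.card_union_of_disjoint, total_cons, hPc, size_ofSet hQt,
                Finset.inter_eq_left.mpr hQ', add_comm]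
              exact Finset.disjoint_left.mpr fun x hx hx' => notMem_block_half d (hP' hx) (hQ' hx')
            · have hfar' : ofSet (K ∪ (P ∪ Q)) ℓ (half (!d) ℓ b) = ofSet Q ℓ (half (!d) ℓ b) := by
                refine ofSet_congr ?_
                rw [Finset.union_inter_distrib_right, hfar, Finset.empty_union,
                  Finset.union_inter_distrib_right, Finset.union_eq_right]
                intro x hx
                rw [Finset.mem_inter] at hx
                exact absurd hx.2 (notMem_block_half d (hP' hx.1))
              rw [ofSet_succ _ d, hfar', hQt, ← Finset.union_assoc, ofSet_half_union _ d hQ', hPt]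
              rfl

lemma Base.card_le_of_separated (hB : Base q k m N φ) (d : Bool) (h : Hole q φ N k c K M ℓ b)
    (hs : ∀ x ∈ K ∩ block ℓ b, ∀ y ∈ M, if d then y < x else x < y) :
    M.card ≤ ((K ∩ block ℓ b).card + 1) * (9 * 4 ^ (q + 1) * m) := by
  induction hn : (K ∩ block ℓ b).card using Nat.strong_induction_on generalizing M ℓ b with
  | _ n ih =>
  rcases Finset.eq_empty_or_nonempty (K ∩ block ℓ b) with hK | hK
  · have h₁ := hB.card_le_of_inter_eq_empty h hK
    have h₂ : 4 * 4 ^ (q + 1) * m ≤ 9 * 4 ^ (q + 1) * m := by gcongr; norm_num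
    exact (h₁.trans h₂).trans (Nat.le_mul_of_pos_left _ (by omega))
  · obtain ⟨M₁, U, sp, h1, h2, h3, h4, h5, h6⟩ := h.exists_spine d hK hs
    obtain ⟨hℓ, hM, w, G, hG, hw, hc⟩ := h
    have ht : total sp ≤ 9 * 4 ^ (q + 1) * m := by
      refine hB.total_le_spineD (c := c) d hℓ h4 hG (by omega) fun sp' hsp hq => ?_
      obtain ⟨P, hP, hPc, hPt⟩ := h5 sp' hsp
      exact hc P hP (hPc.trans hq) _ hPt
    have h₁ : M₁.card ≤ n * (9 * 4 ^ (q + 1) * m) := by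
      rcases h6 with rfl | ⟨ℓ', b', hH, hlt⟩
      · simp
      · have hcard := Finset.card_lt_card hlt
        exact (ih _ (hn ▸ hcard) hH (fun x hx y hy => hs x (hlt.subset hx) y (h1 hy)) rfl).trans
          (Nat.mul_le_mul_right _ (by omega))
    rw [add_mul, one_mul]
    omega

lemma Base.card_le (hB : Base q k m N φ) (hm : 1 ≤ m) {K₀ K₁ : Finset ℕ}
    (h : Hole q φ N k c (K₀ ∪ K₁) M ℓ b) (h₀ : ∀ x ∈ K₀, ∀ y ∈ M, x < y)
    (h₁ : ∀ x ∈ K₁, ∀ y ∈ M, y < x) : M.card ≤ 2 * ((k + 1) * (9 * 4 ^ (q + 1) * m)) := by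
  induction ℓ generalizing b M with
  | zero =>
    have hM := Finset.card_le_card h.2.1
    rw [block, Nat.card_Ico] at hM
    have : 0 < (k + 1) * (9 * 4 ^ (q + 1) * m) := by positivity
    omega
  | succ ℓ ih =>
    by_cases hd : ∃ d, M ⊆ block ℓ (half d ℓ b)
    · obtain ⟨d, hd⟩ := hd
      exact ih (h.descend d subset_rfl hd) h₀ h₁
    · have hhalf : ∀ d, (M ∩ block ℓ (half d ℓ b)).card ≤ (k + 1) * (9 * 4 ^ (q + 1) * m) := by
        intro d
        have hH := h.descend d Finset.inter_subset_left
          (Finset.inter_subset_right (s₁ := M) (s₂ := block ℓ (half d ℓ b)))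
        obtain ⟨-, -, w, -, -, hw, -⟩ := id hH
        refine (hB.card_le_of_separated d hH fun x hx y hy => ?_).trans
          (Nat.mul_le_mul_right _ (by omega))
        obtain ⟨z, hz, hzd⟩ := Finset.not_subset.mp (not_exists.mp hd d)
        have hz' := ((mem_block_succ d).mp (h.2.1 hz)).resolve_left hzd
        rw [Finset.mem_inter, Finset.mem_union] at hx
        have hy := (Finset.mem_inter.mp hy).1
        have hxz := block_half_lt d hx.2 hz'
        rcases hx.1 with hx₀ | hx₁
        · have := h₀ x hx₀ y hy
          have := h₀ x hx₀ z hz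
          cases d <;> simp at hxz ⊢ <;> omega
        · have := h₁ x hx₁ y hy
          have := h₁ x hx₁ z hz
          cases d <;> simp at hxz ⊢ <;> omega
      have hMc := card_inter_block_succ M false ℓ b
      rw [Finset.inter_eq_left.mpr h.2.1] at hMc
      have := hhalf false
      have := hhalf (!false)
      omega

end BTree

/-- The stepped-up coloring of the subsets of `{1,…,2 ^ N}`. -/
def stepColor (q : ℕ) (φ : Finset ℕ → Bool) (N : ℕ) (X : Finset ℕ) : Bool :=
  match BTree.ofSet X N 1 with
  | some t => t.col q φ
  | none => false

lemma BTree.Base.not_hasMonoSimpleDaisy {q k m N : ℕ} {φ : Finset ℕ → Bool}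
    (hB : Base q k m N φ) (hm : 1 ≤ m) {m' : ℕ}
    (hm' : 2 * ((k + 1) * (9 * 4 ^ (q + 1) * m)) < m') :
    ¬HasMonoSimpleDaisy (q + 1) m' k (2 ^ N) (stepColor q φ N) := by
  rintro ⟨K₀, M, K₁, hsub, h₀, h₁, -, hK, hM, c, hc⟩
  have hblock : M ⊆ block N 1 := by
    intro y hy
    have := Finset.mem_Icc.mp (hsub (by simp [hy] : y ∈ K₀ ∪ M ∪ K₁))
    rw [mem_block]
    omega
  have hH : Hole q φ N k c (K₀ ∪ K₁) M N 1 := by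
    refine ⟨le_rfl, hblock, 0, _, .id, ?_, fun P hP hq t ht => ?_⟩
    · exact hK ▸ Finset.card_le_card Finset.inter_subset_left
    · rw [← hc P hP hq, Finset.union_right_comm, stepColor, ht]
  have := hB.card_le hm hH h₀ fun x hx y hy => h₁ y hy x hx
  omega

lemma HasMonoSimpleDaisy.mono {r m k N N' : ℕ} {c : Finset ℕ → Bool}
    (h : HasMonoSimpleDaisy r m k N c) (hN : N ≤ N') : HasMonoSimpleDaisy r m k N' c := by
  obtain ⟨K₀, M, K₁, hsub, h⟩ := h
  exact ⟨K₀, M, K₁, hsub.trans (Finset.Icc_subset_Icc_right hN), h⟩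

lemma HasMonoSimpleDaisy.congr {r m k N : ℕ} {c c' : Finset ℕ → Bool}
    (h : HasMonoSimpleDaisy r m k N c) (hc : ∀ S : Finset ℕ, S.card = k + r → c S = c' S) :
    HasMonoSimpleDaisy r m k N c' := by
  obtain ⟨K₀, M, K₁, hsub, h₀, h₁, h₂, hK, hM, b, hb⟩ := h
  refine ⟨K₀, M, K₁, hsub, h₀, h₁, h₂, hK, hM, b, fun P hP hr => ?_⟩
  rw [← hc, hb P hP hr]
  rw [Finset.union_right_comm, Finset.card_union_of_disjoint, hK, hr]
  refine Finset.disjoint_left.mpr fun x hx hxP => ?_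
  rcases Finset.mem_union.mp hx with hx | hx
  · exact lt_irrefl x (h₀ x hx x (hP hxP))
  · exact lt_irrefl x (h₁ x (hP hxP) x hx)

/-- A finite version of Ramsey's theorem for `2`-colorings of `r`-sets. -/
theorem exists_isMonoOn (r m : ℕ) : ∃ N, ∀ (c : Finset ℕ → Bool) (S : Finset ℕ), N ≤ S.card →
    ∃ T ⊆ S, T.card = m ∧ IsMonoOn c r T := by
  induction r generalizing m with
  | zero =>
    refine ⟨m, fun c S hS => ?_⟩
    obtain ⟨T, hT, hc⟩ := Finset.exists_subset_card_eq hS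
    exact ⟨T, hT, hc, c ∅, fun P _ hP => by rw [Finset.card_eq_zero.mp hP]⟩
  | succ r ih =>
    have hend : ∀ n, ∃ N, ∀ (c : Finset ℕ → Bool) (S : Finset ℕ), N ≤ S.card →
        ∃ T ⊆ S, T.card = n ∧ ∃ f : ℕ → Bool, ∀ x ∈ T, ∀ P ⊆ T, P.card = r → (∀ y ∈ P, x < y) →
          c (insert x P) = f x := by
      intro n
      induction n with
      | zero =>
        exact ⟨0, fun c S _ => ⟨∅, Finset.empty_subset S, rfl, fun _ => false,
          fun x hx => absurd hx (Finset.notMem_empty x)⟩⟩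
      | succ n ihn =>
        obtain ⟨N, hN⟩ := ihn
        obtain ⟨R, hR⟩ := ih N
        refine ⟨R + 1, fun c S hS => ?_⟩
        have hne : S.Nonempty := Finset.card_pos.mp (by omega)
        have hmin := S.min'_mem hne
        set x₀ := S.min' hne with hx₀
        obtain ⟨S', hS', hcard, b, hb⟩ := hR (fun P => c (insert x₀ P)) (S.erase x₀)
          (by rw [Finset.card_erase_of_mem hmin]; omega)
        obtain ⟨T, hT, hTc, f, hf⟩ := hN c S' hcard.ge
        have hTS := hT.trans hS'
        have hlt : ∀ y ∈ T, x₀ < y := fun y hy => by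
          have hy := Finset.mem_erase.mp (hTS hy)
          exact lt_of_le_of_ne (S.min'_le y hy.2) hy.1.symm
        have hsub : ∀ x ∈ insert x₀ T, ∀ P ⊆ insert x₀ T, (∀ y ∈ P, x < y) → P ⊆ T := by
          intro x hx P hP hPx y hy
          refine (Finset.mem_insert.mp (hP hy)).resolve_left ?_
          rintro rfl
          have := hPx _ hy
          rcases Finset.mem_insert.mp hx with rfl | hx
          · omega
          · have := hlt x hx
            omega
        refine ⟨insert x₀ T, ?_, ?_, Function.update f x₀ b, fun x hx P hP hr hPx => ?_⟩
        · exact Finset.insert_subset hmin (hTS.trans (Finset.erase_subset _ _))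
        · rw [Finset.card_insert_of_notMem fun h => lt_irrefl _ (hlt _ h), hTc]
        · have hPT := hsub x hx P hP hPx
          rcases Finset.mem_insert.mp hx with rfl | hx
          · rw [Function.update_self]
            exact hb P (hPT.trans hT) hr
          · rw [Function.update_of_ne (hlt x hx).ne']
            exact hf x hx P hPT hr hPx
    obtain ⟨N, hN⟩ := hend (2 * m)
    refine ⟨N, fun c S hS => ?_⟩
    obtain ⟨T, hT, hTc, f, hf⟩ := hN c S hS
    obtain ⟨b, hb⟩ : ∃ b, m ≤ (T.filter fun x => f x = b).card := by
      by_contra! h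
      have h₁ := h true
      have h₂ := h false
      have h₃ := T.card_filter_add_card_filter_not fun x => f x = true
      simp only [Bool.not_eq_true] at h₃
      omega
    obtain ⟨U, hU, hUc⟩ := Finset.exists_subset_card_eq hb
    have hUT := hU.trans (Finset.filter_subset _ _)
    refine ⟨U, hUT.trans hT, hUc, b, fun P hP hr => ?_⟩
    have hne : P.Nonempty := Finset.card_pos.mp (by omega)
    have hmin := P.min'_mem hne
    rw [← Finset.insert_erase hmin, hf _ (hUT (hP hmin)) _
      ((Finset.erase_subset _ _).trans (hP.trans hUT))
      (by rw [Finset.card_erase_of_mem hmin, hr]; rfl)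
      fun y hy => P.min'_lt_of_mem_erase_min' hne hy]
    exact (Finset.mem_filter.mp (hU (hP hmin))).2

lemma exists_hasMonoSimpleDaisy (r m k : ℕ) :
    ∃ N, ∀ c : Finset ℕ → Bool, HasMonoSimpleDaisy r m k N c := by
  obtain ⟨N, hN⟩ := exists_isMonoOn r m
  refine ⟨N + k, fun c => ?_⟩
  obtain ⟨M, hM, hMc, b, hb⟩ := hN (fun P => c (P ∪ Finset.Ioc N (N + k))) (Finset.Icc 1 N)
    (by simp)
  refine ⟨∅, M, Finset.Ioc N (N + k), ?_, by simp, fun y hy z hz => ?_, by simp, by simp, hMc, b,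
    fun P hP hr => ?_⟩
  · intro x hx
    rw [Finset.empty_union, Finset.mem_union] at hx
    rw [Finset.mem_Icc]
    rcases hx with hx | hx
    · have := Finset.mem_Icc.mp (hM hx)
      omega
    · have := Finset.mem_Ioc.mp hx
      omega
  · have := Finset.mem_Icc.mp (hM hy)
    have := Finset.mem_Ioc.mp hz
    omega
  · rw [Finset.empty_union]
    exact hb P hP hr

lemma lt_simpleDaisyRamsey {r m k N : ℕ} {c : Finset ℕ → Bool}
    (h : ¬HasMonoSimpleDaisy r m k N c) : N < simpleDaisyRamsey r m k := by
  by_contra! hN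
  exact h ((Nat.sInf_mem (exists_hasMonoSimpleDaisy r m k) c).mono hN)

/-- A family of less than `2 ^ (a - 1)` sets with at least `a` elements each has a proper
`2`-coloring. -/
lemma exists_splitting {α : Type*} [DecidableEq α] {F : Finset (Finset α)} {a : ℕ}
    (ha : ∀ D ∈ F, a ≤ D.card) (hF : 2 * F.card < 2 ^ a) :
    ∃ A : Finset α, ∀ D ∈ F, ¬D ⊆ A ∧ ¬Disjoint A D := by
  rcases F.eq_empty_or_nonempty with rfl | ⟨D₀, hD₀⟩
  · exact ⟨∅, by simp⟩
  set E := F.biUnion id with hE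
  have hsub : ∀ D ∈ F, D ⊆ E := fun D hD => Finset.subset_biUnion_of_mem id hD
  have haE : a ≤ E.card := (ha D₀ hD₀).trans (Finset.card_le_card (hsub D₀ hD₀))
  set bad := F.biUnion fun D => Finset.Icc D E ∪ (E \ D).powerset with hbad
  have hcard : bad.card ≤ F.card * (2 * 2 ^ (E.card - a)) := by
    refine Finset.card_biUnion_le_card_mul _ _ _ fun D hD => (Finset.card_union_le _ _).trans ?_
    rw [Finset.card_Icc_finset (hsub D hD), Finset.card_powerset,
      Finset.card_sdiff_of_subset (hsub D hD), ← two_mul]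
    gcongr
    · norm_num
    · exact ha D hD
  have hlt : bad.card < E.powerset.card := by
    rw [Finset.card_powerset]
    calc bad.card ≤ 2 * F.card * 2 ^ (E.card - a) := hcard.trans (by ring_nf; rfl)
      _ < 2 ^ a * 2 ^ (E.card - a) := Nat.mul_lt_mul_of_pos_right hF (by positivity)
      _ = 2 ^ E.card := by rw [← pow_add, Nat.add_sub_cancel' haE]
  obtain ⟨A, hA, hAb⟩ := Finset.exists_mem_notMem_of_card_lt_card hlt
  rw [Finset.mem_powerset] at hA
  refine ⟨A, fun D hD => ⟨fun h => hAb ?_, fun h => hAb ?_⟩⟩ <;>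
    refine Finset.mem_biUnion.mpr ⟨D, hD, Finset.mem_union.mpr ?_⟩
  · exact .inl (Finset.mem_Icc.mpr ⟨h, hA⟩)
  · exact .inr (Finset.mem_powerset.mpr (Finset.subset_sdiff.mpr ⟨hA, h⟩))

lemma exists_not_hasMonoSimpleDaisy_of_lt {r m k N : ℕ}
    (h : 2 * N ^ (k + m) < 2 ^ m.choose r) : ∃ c, ¬HasMonoSimpleDaisy r m k N c := by
  set S := (Finset.powersetCard k (Finset.Icc 1 N) ×ˢ Finset.powersetCard m (Finset.Icc 1 N)).filter
    fun x => Disjoint x.1 x.2 with hS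
  set F := S.image fun x => (Finset.powersetCard r x.2).image (x.1 ∪ ·) with hF
  have ha : ∀ D ∈ F, m.choose r ≤ D.card := by
    intro D hD
    obtain ⟨⟨K, M⟩, hx, rfl⟩ := Finset.mem_image.mp hD
    simp only [hS, Finset.mem_filter, Finset.mem_product, Finset.mem_powersetCard] at hx
    rw [Finset.card_image_of_injOn, Finset.card_powersetCard, hx.1.2.2]
    intro P hP Q hQ hPQ
    simp only [Finset.mem_coe, Finset.mem_powersetCard] at hP hQ
    have hd := Finset.disjoint_left.mp hx.2
    ext y
    have hy := Finset.ext_iff.mp hPQ y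
    simp only [Finset.mem_union] at hy
    have := @hd y
    have := @hP.1 y
    have := @hQ.1 y
    tauto
  have hcard : F.card ≤ N ^ (k + m) := by
    refine Finset.card_image_le.trans ((Finset.card_filter_le _ _).trans ?_)
    rw [Finset.card_product, Finset.card_powersetCard, Finset.card_powersetCard, Nat.card_Icc,
      pow_add]
    exact Nat.mul_le_mul (Nat.choose_le_pow _ _) (Nat.choose_le_pow _ _)
  obtain ⟨A, hA⟩ := exists_splitting ha (by omega)
  refine ⟨fun X => decide (X ∈ A), ?_⟩
  rintro ⟨K₀, M, K₁, hsub, h₀, h₁, -, hK, hM, b, hb⟩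
  have hx : (K₀ ∪ K₁, M) ∈ S := by
    simp only [hS, Finset.mem_filter, Finset.mem_product, Finset.mem_powersetCard]
    rw [Finset.union_right_comm] at hsub
    refine ⟨⟨⟨Finset.union_subset_left hsub, hK⟩, Finset.union_subset_right hsub, hM⟩, ?_⟩
    refine Finset.disjoint_left.mpr fun x hx hxM => ?_
    rcases Finset.mem_union.mp hx with hx | hx
    · exact lt_irrefl x (h₀ x hx x hxM)
    · exact lt_irrefl x (h₁ x hxM x hx)
  obtain ⟨hA₁, hA₂⟩ := hA _ (Finset.mem_image_of_mem _ hx)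
  have hbP : ∀ P ∈ Finset.powersetCard r M, decide (K₀ ∪ K₁ ∪ P ∈ A) = b := fun P hP => by
    rw [Finset.mem_powersetCard] at hP
    rw [← hb P hP.1 hP.2, Finset.union_right_comm]
  cases b with
  | true =>
    refine hA₁ fun X hX => ?_
    obtain ⟨P, hP, rfl⟩ := Finset.mem_image.mp hX
    exact of_decide_eq_true (hbP P hP)
  | false =>
    refine hA₂ (Finset.disjoint_right.mpr fun X hX => ?_)
    obtain ⟨P, hP, rfl⟩ := Finset.mem_image.mp hX
    exact of_decide_eq_false (hbP P hP)

lemma exists_coloring_three {k m : ℕ} (hk : k ≤ m) (hm : 7 ≤ m) :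
    ∃ N : ℕ, tower 1 (1 / 48 * (m : ℝ) ^ 2) ≤ N ∧ ∃ c, ¬HasMonoSimpleDaisy 3 m k N c := by
  refine ⟨2 ^ (m ^ 2 / 24), ?_, exists_not_hasMonoSimpleDaisy_of_lt ?_⟩
  · have h₁ : m ^ 2 ≤ 48 * (m ^ 2 / 24) := by
      have : 7 ^ 2 ≤ m ^ 2 := Nat.pow_le_pow_left hm 2
      omega
    have h₂ : (m : ℝ) ^ 2 ≤ 48 * (m ^ 2 / 24 : ℕ) := by exact_mod_cast h₁
    simp only [tower]
    rw [Nat.cast_pow, Nat.cast_two, ← Real.rpow_natCast 2]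
    exact Real.rpow_le_rpow_of_exponent_le one_le_two (by linarith)
  · rw [← pow_mul, mul_comm 2, ← pow_succ]
    refine Nat.pow_lt_pow_right (by norm_num) ?_
    have hchoose : 6 * m.choose 3 = m * (m - 1) * (m - 2) := by
      have := Nat.descFactorial_eq_factorial_mul_choose m 3
      simp only [Nat.descFactorial, Nat.sub_zero, mul_one] at this
      rw [mul_comm _ (m - 2), mul_comm m, this]
      rfl
    have hdiv : 24 * (m ^ 2 / 24) ≤ m ^ 2 := Nat.mul_div_le _ _
    have hmul : m ^ 2 / 24 * (k + m) ≤ m ^ 2 / 24 * (2 * m) := Nat.mul_le_mul_left _ (by omega)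
    have hmul' : 24 * (m ^ 2 / 24) * m ≤ m ^ 2 * m := Nat.mul_le_mul_right _ hdiv
    obtain ⟨n, rfl⟩ := Nat.exists_eq_add_of_le hm
    have h₁ : 7 + n - 1 = 6 + n := by omega
    have h₂ : 7 + n - 2 = 5 + n := by omega
    rw [h₁, h₂] at hchoose
    nlinarith

lemma tower_mono (i : ℕ) : Monotone (tower i) := by
  induction i with
  | zero => exact monotone_id
  | succ i ih => exact fun x y h => Real.rpow_le_rpow_of_exponent_le one_le_two (ih h)

/-- The colorings of the sets of each size `q + j` with `j ≤ k`, combined into one. -/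
lemma exists_base {q k m : ℕ} (hq : 3 ≤ q) {x : ℝ}
    (h : ∀ j ≤ k, ∃ N : ℕ, x ≤ N ∧ ∃ c, ¬HasMonoSimpleDaisy q m j N c) :
    ∃ N : ℕ, x ≤ N ∧ ∃ φ, BTree.Base q k m N φ := by
  choose! N hN c hc using h
  obtain ⟨i, hi, hmin⟩ := Finset.exists_min_image (Finset.range (k + 1)) N ⟨0, by simp⟩
  simp only [Finset.mem_range, Nat.lt_succ_iff] at hi hmin
  refine ⟨N i, hN i hi, fun S => if S.card < q then false else c (S.card - q) S, hq,
    fun S hS => if_pos hS, fun j hj hd => hc j hj ((hd.congr fun S hS => ?_).mono (hmin j hj))⟩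
  rw [if_neg (by omega), hS, Nat.add_sub_cancel]

lemma exists_coloring (s k : ℕ) : ∃ ε : ℝ, 0 < ε ∧ ∃ m₀ : ℕ, ∀ m ≥ m₀, ∃ N : ℕ,
    tower (s + 1) (ε * (m : ℝ) ^ 2) ≤ N ∧ ∃ c, ¬HasMonoSimpleDaisy (s + 3) m k N c := by
  induction s generalizing k with
  | zero => exact ⟨1 / 48, by norm_num, max k 7, fun m hm => exists_coloring_three
      ((le_max_left _ _).trans hm) ((le_max_right _ _).trans hm)⟩
  | succ s ih =>
    choose ε hε m₀ hm₀ using ih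
    obtain ⟨i, -, hi⟩ := Finset.exists_min_image (Finset.range (k + 1)) ε ⟨0, by simp⟩
    obtain ⟨i', -, hi'⟩ := Finset.exists_max_image (Finset.range (k + 1)) m₀ ⟨0, by simp⟩
    simp only [Finset.mem_range, Nat.lt_succ_iff] at hi hi'
    set F := 2 * ((k + 1) * (9 * 4 ^ (s + 3 + 1))) + 1 with hF
    have hF0 : 0 < F := by omega
    refine ⟨ε i / (4 * F ^ 2), by have := hε i; positivity, F * (m₀ i' + 1), fun M hM => ?_⟩
    set m := M / F with hm
    have hmge : m₀ i' + 1 ≤ m := by rwa [hm, Nat.le_div_iff_mul_le hF0, mul_comm]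
    have hMle : M ≤ 2 * F * m := by
      have := Nat.lt_mul_div_succ M hF0
      rw [← hm] at this
      nlinarith
    obtain ⟨N, hN, φ, hφ⟩ := exists_base (q := s + 3) (k := k) (m := m)
      (x := tower (s + 1) (ε i * (m : ℝ) ^ 2)) (by omega) fun j hj => by
        obtain ⟨N, hN, hc⟩ := hm₀ j m (by have := hi' j hj; omega)
        refine ⟨N, (tower_mono _ ?_).trans hN, hc⟩
        gcongr
        exact hi j hj
    refine ⟨2 ^ N, ?_, _, hφ.not_hasMonoSimpleDaisy (by omega) ?_⟩
    · rw [tower]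
      rw [Nat.cast_pow, Nat.cast_two, ← Real.rpow_natCast 2]
      refine Real.rpow_le_rpow_of_exponent_le one_le_two ((tower_mono _ ?_).trans hN)
      have hFR : (0 : ℝ) < F := by exact_mod_cast hF0
      have hMR : (M : ℝ) ≤ 2 * F * m := by exact_mod_cast hMle
      rw [div_mul_eq_mul_div, div_le_iff₀ (by positivity), mul_assoc]
      refine mul_le_mul_of_nonneg_left ?_ (hε i).le
      calc (M : ℝ) ^ 2 ≤ (2 * F * m) ^ 2 := by gcongr
        _ = _ := by ring
    · calc 2 * ((k + 1) * (9 * 4 ^ (s + 3 + 1) * m)) < F * m := by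
            rw [hF]
            nlinarith
        _ ≤ M := Nat.mul_div_le M F

/-- Main technical theorem: there is an absolute constant `c > 0` such that for all
`r ≥ 3`, `k ≥ 1` there is `m₀ = m₀(r,k)` with
`D_r^{smp}(m,k) ≥ t_{r-2}(c · k^{2^{4-r}-2} · m^{2^{4-r}})` for all `m ≥ m₀`. -/
theorem simpleDaisyRamsey_lower : ∃ c : ℝ, 0 < c ∧
    ∀ r k : ℕ, 3 ≤ r → 1 ≤ k → ∃ m₀ : ℕ, ∀ m : ℕ, m₀ ≤ m →
      tower (r - 2)
        (c * (k : ℝ) ^ ((2 : ℝ) ^ ((4 : ℝ) - (r : ℝ)) - 2)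
           * (m : ℝ) ^ ((2 : ℝ) ^ ((4 : ℝ) - (r : ℝ))))
        ≤ (simpleDaisyRamsey r m k : ℝ) := by
  refine ⟨1 / 48, by norm_num, fun r k hr hk => ?_⟩
  obtain ⟨s, rfl⟩ := Nat.exists_eq_add_of_le' hr
  rw [show s + 3 - 2 = s + 1 by omega]
  rcases Nat.eq_zero_or_pos s with rfl | hs
  · refine ⟨max k 7, fun m hm => ?_⟩
    obtain ⟨N, hN, c, hc⟩ := exists_coloring_three ((le_max_left k 7).trans hm)
      ((le_max_right k 7).trans hm)
    have he : (2 : ℝ) ^ ((4 : ℝ) - ((0 + 3 : ℕ) : ℝ)) = 2 := by norm_num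
    rw [he, sub_self, Real.rpow_zero, mul_one, Real.rpow_two]
    exact hN.trans (by exact_mod_cast (lt_simpleDaisyRamsey hc).le)
  · obtain ⟨ε, hε, m₀, hm₀⟩ := exists_coloring s k
    refine ⟨max (max m₀ 1) ⌈1 / ε⌉₊, fun m hm => ?_⟩
    simp only [max_le_iff] at hm
    obtain ⟨N, hN, c, hc⟩ := hm₀ m hm.1.1
    refine ((tower_mono _ ?_).trans hN).trans (by exact_mod_cast (lt_simpleDaisyRamsey hc).le)
    have he : (2 : ℝ) ^ ((4 : ℝ) - ((s + 3 : ℕ) : ℝ)) ≤ 1 := by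
      refine Real.rpow_le_one_of_one_le_of_nonpos one_le_two ?_
      have : (1 : ℝ) ≤ s := by exact_mod_cast hs
      push_cast
      linarith
    have hkR : (1 : ℝ) ≤ k := by exact_mod_cast hk
    have hmR : (1 : ℝ) ≤ m := by exact_mod_cast hm.1.2
    have h₁ : (k : ℝ) ^ ((2 : ℝ) ^ ((4 : ℝ) - ((s + 3 : ℕ) : ℝ)) - 2) ≤ 1 :=
      Real.rpow_le_one_of_one_le_of_nonpos hkR (by linarith)
    have h₂ : (m : ℝ) ^ ((2 : ℝ) ^ ((4 : ℝ) - ((s + 3 : ℕ) : ℝ))) ≤ m := by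
      simpa using Real.rpow_le_rpow_of_exponent_le hmR he
    have h₃ : 1 ≤ ε * m := by
      have := Nat.ceil_le.mp hm.2
      rwa [div_le_iff₀' hε] at this
    calc _ ≤ 1 / 48 * 1 * (m : ℝ) := by gcongr
      _ ≤ 1 * m := by linarith
      _ ≤ ε * m * m := by gcongr
      _ = ε * (m : ℝ) ^ 2 := by ring
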